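/- Assume Assumption A0. Let N, M ≥ 1 be integers with N ≤ ⌈M/2⌉, and let r, μ ∈ ℕ with r ≤ μ ≤ min(2N, M). Let N_e ≥ 1 be an integer with ν̂_{N_e} = N_eπ/(κĥ₁) ≥ √2. Then for any u ∈ S^{N,M}_κ(K̂,ŝ): inf over v ∈ span{φ̂_n : 1 ≤ n ≤ N_e} of ‖u − v‖_{H^r_κ(K̂)} is at most (√2·(r+1)/√(κ·tanh(κĥ₂))) · ν̂_{N_e}^{r−(μ+1/2)} · |u|_{H^μ_κ(ŝ)}, where |u|_{H^μ_κ(ŝ)} := κ^{−μ}·‖∂₁^μ(u|_ŝ)‖_{L²(ŝ)}. If moreover u ∈ H^{M+1}_κ(K̂), then this infimum is at most (2(r+1)·max(1,κĥ₂)/√(κĥ₂·tanh(κĥ₂))) · ν̂_{N_e}^{r−(μ+1/2)} · ‖u‖_{H^{μ+1}_κ(K̂)}. -/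

import Mathlib

open MeasureTheory Real Set
open scoped Real Classical ENNReal NNReal

noncomputable section

/-- Partial derivative in the first coordinate. -/
def pd1 (f : ℝ × ℝ → ℂ) : ℝ × ℝ → ℂ := fun x => deriv (fun t => f (t, x.2)) x.1

/-- Partial derivative in the second coordinate. -/
def pd2 (f : ℝ × ℝ → ℂ) : ℝ × ℝ → ℂ := fun x => deriv (fun t => f (x.1, t)) x.2

/-- Mixed partial derivative `∂₁^i ∂₂^j`. -/
def pdM (i j : ℕ) (f : ℝ × ℝ → ℂ) : ℝ × ℝ → ℂ := pd1^[i] (pd2^[j] f)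

/-- Multi-indices of order at most `M`. -/
def idxLe (M : ℕ) : Finset (ℕ × ℕ) :=
  (Finset.range (M + 1) ×ˢ Finset.range (M + 1)).filter fun p => p.1 + p.2 ≤ M

/-- κ-weighted Sobolev inner product of order `M` on `D`. -/
def sobInner (κ : ℝ) (M : ℕ) (D : Set (ℝ × ℝ)) (f g : ℝ × ℝ → ℂ) : ℂ :=
  ∑ p ∈ idxLe M, ((κ : ℂ) ^ (2 * (p.1 + p.2)))⁻¹ *
    ∫ x in D, pdM p.1 p.2 f x * (starRingEnd ℂ) (pdM p.1 p.2 g x)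

/-- Square of the κ-weighted Sobolev norm of order `M` on `D`. -/
def sobNormSq (κ : ℝ) (M : ℕ) (D : Set (ℝ × ℝ)) (f : ℝ × ℝ → ℂ) : ℝ :=
  ∑ p ∈ idxLe M, (κ ^ (2 * (p.1 + p.2)))⁻¹ * ∫ x in D, ‖pdM p.1 p.2 f x‖ ^ 2

/-- κ-weighted Sobolev norm of order `M` on `D`. -/
def sobNorm (κ : ℝ) (M : ℕ) (D : Set (ℝ × ℝ)) (f : ℝ × ℝ → ℂ) : ℝ :=
  Real.sqrt (sobNormSq κ M D f)

/-- Membership in `H^M_κ(D)` (for pointwise-differentiable representatives). -/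
def MemSob (M : ℕ) (D : Set (ℝ × ℝ)) (f : ℝ × ℝ → ℂ) : Prop :=
  ∀ p ∈ idxLe M, IntegrableOn (fun x => ‖pdM p.1 p.2 f x‖ ^ 2) D

/-- `ν̂_n = nπ/(κ ĥ₁)`. -/
def nuHat (κ h1 : ℝ) (n : ℕ) : ℝ := n * π / (κ * h1)

/-- Principal complex square root of a real number. -/
def csqrt (r : ℝ) : ℂ := (r : ℂ) ^ (1 / 2 : ℂ)

/-- The single-edge Helmholtz mode `φ̂_n` on the reference rectangle. -/
def phiHat (κ h1 h2 : ℝ) (n : ℕ) : ℝ × ℝ → ℂ := fun x =>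
  Complex.sin (↑(κ * nuHat κ h1 n) * (x.1 : ℂ)) *
    Complex.sin ((x.2 : ℂ) * (κ : ℂ) * csqrt (1 - nuHat κ h1 n ^ 2)) /
    Complex.sin ((h2 : ℂ) * (κ : ℂ) * csqrt (1 - nuHat κ h1 n ^ 2))

/-- The open reference rectangle `K̂ = (0,ĥ₁) × (0,ĥ₂)`. -/
def Khat (h1 h2 : ℝ) : Set (ℝ × ℝ) := Ioo 0 h1 ×ˢ Ioo 0 h2

/-- Assumption A0: `κ²` is not a Δ-Neumann eigenvalue of the rectangle with sides `h1, h2`. -/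
def A0cond (κ h1 h2 : ℝ) : Prop :=
  ∀ n m : ℕ, κ ^ 2 ≠ (n * π / h1) ^ 2 + (m * π / h2) ^ 2

/-- Distributional (weak) solution of the homogeneous Helmholtz equation on `D`. -/
def WeakHelmholtz (κ : ℝ) (D : Set (ℝ × ℝ)) (u : ℝ × ℝ → ℂ) : Prop :=
  IntegrableOn u D ∧
  ∀ φ : ℝ × ℝ → ℂ, ContDiff ℝ (⊤ : ℕ∞) φ → HasCompactSupport φ → tsupport φ ⊆ D →
    ∫ x in D, u x * (pdM 2 0 φ x + pdM 0 2 φ x + (κ : ℂ) ^ 2 * φ x) = 0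

/-- The trace of `u` on the top edge (at height `h2`). -/
def traceTop (h2 : ℝ) (u : ℝ × ℝ → ℂ) : ℝ → ℂ := fun t => u (t, h2)

/-- The class `S^{N,M}_κ(K̂, ŝ)` of Helmholtz solutions with trace supported on the top edge. -/
structure SLoc (κ h1 h2 : ℝ) (N M : ℕ) (u : ℝ × ℝ → ℂ) : Prop where
  cont : ContinuousOn u (Icc 0 h1 ×ˢ Icc 0 h2)
  mem : MemSob 1 (Khat h1 h2) u
  helm : WeakHelmholtz κ (Khat h1 h2) u
  left : ∀ y ∈ Icc (0 : ℝ) h2, u (0, y) = 0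
  right : ∀ y ∈ Icc (0 : ℝ) h2, u (h1, y) = 0
  bottom : ∀ x ∈ Icc (0 : ℝ) h1, u (x, 0) = 0
  traceReg : ContDiffOn ℝ M (traceTop h2 u) (Icc 0 h1)
  endpt0 : ∀ j < N, iteratedDerivWithin (2 * j) (traceTop h2 u) (Icc 0 h1) 0 = 0
  endpt1 : ∀ j < N, iteratedDerivWithin (2 * j) (traceTop h2 u) (Icc 0 h1) h1 = 0

/-- Square of the trace seminorm `|u|_{H^M_κ(ŝ)}`. -/
def traceSemiSq (κ h1 h2 : ℝ) (M : ℕ) (u : ℝ × ℝ → ℂ) : ℝ :=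
  (κ ^ (2 * M))⁻¹ * ∫ t in (0 : ℝ)..h1, ‖iteratedDerivWithin M (traceTop h2 u) (Icc 0 h1) t‖ ^ 2

/-- The `L²(ŝ)` inner product of traces on the top edge. -/
def traceL2Inner (h1 h2 : ℝ) (u v : ℝ × ℝ → ℂ) : ℂ :=
  ∫ t in (0 : ℝ)..h1, u (t, h2) * (starRingEnd ℂ) (v (t, h2))

/-- The squared `L²(ŝ)` norm of the trace on the top edge. -/
def traceL2Sq (h1 h2 : ℝ) (u : ℝ × ℝ → ℂ) : ℝ :=
  ∫ t in (0 : ℝ)..h1, ‖u (t, h2)‖ ^ 2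

lemma deriv_deriv_cutoff_mul {θ ψ : ℝ → ℂ} (hθ : ContDiff ℝ (⊤ : ℕ∞) θ)
    (hψ : ContDiff ℝ (⊤ : ℕ∞) ψ) (k x : ℝ) :
    deriv (deriv fun t => θ (k * t - 1) * ψ t) x =
      (k : ℂ) ^ 2 * deriv (deriv θ) (k * x - 1) * ψ x
        + 2 * k * deriv θ (k * x - 1) * deriv ψ x + θ (k * x - 1) * deriv (deriv ψ) x := by
  have hdθ : ContDiff ℝ (⊤ : ℕ∞) (deriv θ) := (contDiff_infty_iff_deriv.1 hθ).2
  have hdψ : ContDiff ℝ (⊤ : ℕ∞) (deriv ψ) := (contDiff_infty_iff_deriv.1 hψ).2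
  have key : ∀ f : ℝ → ℂ, ContDiff ℝ (⊤ : ℕ∞) f → ∀ t : ℝ,
      HasDerivAt (fun s => f (k * s - 1)) ((k : ℂ) * deriv f (k * t - 1)) t := by
    intro f hf t
    have h1 : HasDerivAt f (deriv f (k * t - 1)) (k * t - 1) :=
      (hf.differentiable (by simp)).differentiableAt.hasDerivAt
    have h2 : HasDerivAt (fun s : ℝ => k * s - 1) k t := by
      simpa using ((hasDerivAt_id t).const_mul k).sub_const 1
    simpa [Function.comp_def] using h1.scomp t h2
  have key' : ∀ f : ℝ → ℂ, ContDiff ℝ (⊤ : ℕ∞) f → ∀ t : ℝ, HasDerivAt f (deriv f t) t :=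
    fun f hf t => (hf.differentiable (by simp)).differentiableAt.hasDerivAt
  have e1 : (deriv fun t => θ (k * t - 1) * ψ t) =
      fun t => (k : ℂ) * deriv θ (k * t - 1) * ψ t + θ (k * t - 1) * deriv ψ t := by
    funext t
    exact ((key θ hθ t).mul (key' ψ hψ t)).deriv
  rw [e1]
  have h := ((((key _ hdθ x).const_mul (k : ℂ)).mul (key' ψ hψ x)).add
    ((key θ hθ x).mul (key' _ hdψ x))).deriv
  refine Eq.trans h ?_
  ring

lemma weak_form_of_cutoff_left {h : ℝ} (hh : 0 < h) {F G θ ψ : ℝ → ℂ} (hF : Continuous F)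
    (hG : Continuous G) (F0 : F 0 = 0) (hθ : ContDiff ℝ (⊤ : ℕ∞) θ) (hθ1 : ∀ t, 1 ≤ t → θ t = 1)
    (hψ : ContDiff ℝ (⊤ : ℕ∞) ψ) (ψ0 : ψ 0 = 0)
    (H : ∀ k : ℝ, 0 < k → ∫ x in (0 : ℝ)..h, (F x * deriv (deriv fun t => θ (k * t - 1) * ψ t) x
      + G x * (θ (k * x - 1) * ψ x)) = 0) :
    ∫ x in (0 : ℝ)..h, (F x * deriv (deriv ψ) x + G x * ψ x) = 0 := by
  have hdθ : ContDiff ℝ (⊤ : ℕ∞) (deriv θ) := (contDiff_infty_iff_deriv.1 hθ).2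
  have hdψ : ContDiff ℝ (⊤ : ℕ∞) (deriv ψ) := (contDiff_infty_iff_deriv.1 hψ).2
  have hddθ : Continuous (deriv (deriv θ)) := (contDiff_infty_iff_deriv.1 hdθ).2.continuous
  have hddψ : Continuous (deriv (deriv ψ)) := (contDiff_infty_iff_deriv.1 hdψ).2.continuous
  have bdd : ∀ (f : ℝ → ℂ) (a b : ℝ), Continuous f → ∃ C, ∀ x ∈ Icc a b, ‖f x‖ ≤ C :=
    fun f a b hf => isCompact_Icc.exists_bound_of_continuousOn hf.continuousOn
  obtain ⟨T0, hT0⟩ := bdd θ (-1) 2 hθ.continuous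
  obtain ⟨T1, hT1⟩ := bdd _ (-1) 2 hdθ.continuous
  obtain ⟨T2, hT2⟩ := bdd _ (-1) 2 hddθ
  obtain ⟨P0, hP0⟩ := bdd ψ 0 h hψ.continuous
  obtain ⟨P1, hP1⟩ := bdd _ 0 h hdψ.continuous
  obtain ⟨P2, hP2⟩ := bdd _ 0 h hddψ
  obtain ⟨B, hB⟩ := bdd G 0 h hG
  have m0 : (0 : ℝ) ∈ Icc (0 : ℝ) h := ⟨le_rfl, hh.le⟩
  have m1 : (0 : ℝ) ∈ Icc (-1 : ℝ) 2 := by constructor <;> norm_num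
  have T0p := (norm_nonneg _).trans (hT0 0 m1)
  have T1p := (norm_nonneg _).trans (hT1 0 m1)
  have T2p := (norm_nonneg _).trans (hT2 0 m1)
  have P0p := (norm_nonneg _).trans (hP0 0 m0)
  have P1p := (norm_nonneg _).trans (hP1 0 m0)
  have P2p := (norm_nonneg _).trans (hP2 0 m0)
  have Bp := (norm_nonneg _).trans (hB 0 m0)
  have hlin : ∀ x ∈ Icc (0 : ℝ) h, ‖ψ x‖ ≤ P1 * x := by
    intro x hx
    have := (convex_Icc (0 : ℝ) h).norm_image_sub_le_of_norm_deriv_le (f := ψ) (C := P1)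
      (fun y _ => (hψ.differentiable (by simp)).differentiableAt) hP1 m0 hx
    rw [ψ0, sub_zero, sub_zero, Real.norm_of_nonneg hx.1] at this
    exact this
  set K : ℝ := 3 * T2 * P1 + 2 * T1 * P1 + T0 * P2 + P2 with hK
  have Kp : 0 ≤ K := by positivity
  set L : ℝ := B * (T0 * P0 + P0) with hL
  have Lp : 0 ≤ L := by positivity
  set η : ℝ → ℝ → ℂ := fun k t => θ (k * t - 1) * ψ t with hη
  have hηc : ∀ k : ℝ, ContDiff ℝ (⊤ : ℕ∞) (η k) := fun k =>
    (hθ.comp ((contDiff_const.mul contDiff_id).sub contDiff_const)).mul hψ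
  have hηdd : ∀ k : ℝ, Continuous (deriv (deriv (η k))) := fun k =>
    (contDiff_infty_iff_deriv.1 (contDiff_infty_iff_deriv.1 (hηc k)).2).2.continuous
  rw [← norm_le_zero_iff]
  refine le_of_forall_pos_le_add fun ε hε => ?_
  rw [zero_add]
  obtain ⟨δ, hδ, hFδ⟩ := Metric.continuous_iff.1 hF 0 (ε / (6 * (K + 1))) (by positivity)
  obtain ⟨k, hk⟩ := exists_gt (max 1 (max (3 / h) (max (3 / δ) (6 * (L + 1) / ε))))
  simp only [max_lt_iff] at hk
  obtain ⟨hk1, hkh, hkδ, hkε⟩ := hk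
  have kp : 0 < k := by linarith
  have h3h : 3 / k ≤ h := by
    rw [div_lt_iff₀ hh] at hkh
    rw [div_le_iff₀ kp]; linarith
  have h3δ : 3 / k < δ := by
    rw [div_lt_iff₀ hδ] at hkδ
    rw [div_lt_iff₀ kp]; linarith
  have h3p : 0 ≤ 3 / k := by positivity
  set D : ℝ → ℂ := fun x => F x * (deriv (deriv ψ) x - deriv (deriv (η k)) x)
    + G x * (ψ x - η k x) with hD
  have hDc : Continuous D := by
    have := (hηc k).continuous
    have := hψ.continuous
    have := hηdd k
    fun_prop
  have e1 : ∫ x in (0 : ℝ)..h, (F x * deriv (deriv ψ) x + G x * ψ x) = ∫ x in (0 : ℝ)..h, D x := by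
    have h2 := H k kp
    rw [← sub_zero (∫ x in (0 : ℝ)..h, (F x * deriv (deriv ψ) x + G x * ψ x)), ← h2,
      ← intervalIntegral.integral_sub]
    · refine intervalIntegral.integral_congr fun x _ => ?_
      simp only [hD, hη]; ring
    · exact ((hF.mul hddψ).add (hG.mul hψ.continuous)).intervalIntegrable _ _
    · exact ((hF.mul (hηdd k)).add (hG.mul (hηc k).continuous)).intervalIntegrable _ _
  have e2 : ∫ x in (3 / k)..h, D x = 0 := by
    refine intervalIntegral.integral_zero_ae (Filter.Eventually.of_forall fun x hx => ?_)
    rw [uIoc_of_le h3h] at hx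
    have hev : η k =ᶠ[nhds x] ψ := by
      filter_upwards [eventually_gt_nhds (show 2 / k < x from lt_trans (by gcongr; norm_num) hx.1)]
        with t ht
      rw [div_lt_iff₀ kp] at ht
      simp only [hη]
      rw [hθ1 _ (by linarith), one_mul]
    simp only [hD, hev.deriv.deriv_eq, hev.eq_of_nhds, sub_self, mul_zero, add_zero]
  have e3 : ∫ x in (0 : ℝ)..h, D x = ∫ x in (0 : ℝ)..(3 / k), D x := by
    rw [← intervalIntegral.integral_add_adjacent_intervals (hDc.intervalIntegrable 0 (3 / k))
      (hDc.intervalIntegrable _ h), e2, add_zero]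
  have bound : ∀ x ∈ uIoc (0 : ℝ) (3 / k), ‖D x‖ ≤ ε / (6 * (K + 1)) * (k * K) + L := by
    intro x hx
    rw [uIoc_of_le h3p] at hx
    have hxh : x ∈ Icc (0 : ℝ) h := ⟨hx.1.le, hx.2.trans h3h⟩
    have hkx : k * x ≤ 3 := by
      have := hx.2
      rw [le_div_iff₀ kp] at this
      linarith
    have hkx0 : 0 ≤ k * x := mul_nonneg kp.le hx.1.le
    have hkm : k * x - 1 ∈ Icc (-1 : ℝ) 2 := ⟨by linarith, by linarith⟩
    have hFx : ‖F x‖ ≤ ε / (6 * (K + 1)) := by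
      have := hFδ x (by rw [Real.dist_eq, sub_zero, abs_of_pos hx.1]; linarith [hx.2])
      rw [F0, dist_zero_right] at this
      exact this.le
    have h1 : ‖deriv (deriv ψ) x - deriv (deriv (η k)) x‖ ≤ k * K := by
      rw [hη]
      simp only
      rw [deriv_deriv_cutoff_mul hθ hψ]
      have n1 : ‖(k : ℂ) ^ 2 * deriv (deriv θ) (k * x - 1) * ψ x‖ ≤ k * (3 * T2 * P1) := by
        rw [norm_mul, norm_mul, norm_pow, Complex.norm_real, Real.norm_of_nonneg kp.le]
        calc k ^ 2 * ‖deriv (deriv θ) (k * x - 1)‖ * ‖ψ x‖ ≤ k ^ 2 * T2 * (P1 * x) := by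
              gcongr
              · exact hT2 _ hkm
              · exact hlin x hxh
          _ = k * T2 * P1 * (k * x) := by ring
          _ ≤ k * T2 * P1 * 3 := by gcongr
          _ = _ := by ring
      have n2 : ‖2 * k * deriv θ (k * x - 1) * deriv ψ x‖ ≤ k * (2 * T1 * P1) := by
        rw [norm_mul, norm_mul, norm_mul, Complex.norm_real, Real.norm_of_nonneg kp.le]
        calc ‖(2 : ℂ)‖ * k * ‖deriv θ (k * x - 1)‖ * ‖deriv ψ x‖ ≤ 2 * k * T1 * P1 := by
              gcongr
              · simp
              · exact hT1 _ hkm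
              · exact hP1 x hxh
          _ = _ := by ring
      have n3 : ‖θ (k * x - 1) * deriv (deriv ψ) x‖ ≤ k * (T0 * P2) := by
        rw [norm_mul]
        calc ‖θ (k * x - 1)‖ * ‖deriv (deriv ψ) x‖ ≤ T0 * P2 := by
              gcongr
              · exact hT0 _ hkm
              · exact hP2 x hxh
          _ ≤ k * (T0 * P2) := le_mul_of_one_le_left (by positivity) hk1.le
      have n4 : ‖deriv (deriv ψ) x‖ ≤ k * P2 :=
        (hP2 x hxh).trans (le_mul_of_one_le_left (by positivity) hk1.le)
      refine (norm_sub_le _ _).trans ?_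
      refine (add_le_add n4 (norm_add₃_le.trans (add_le_add (add_le_add n1 n2) n3))).trans ?_
      rw [hK]
      apply le_of_eq
      ring
    have h2 : ‖ψ x - η k x‖ ≤ T0 * P0 + P0 := by
      refine (norm_sub_le _ _).trans ?_
      rw [add_comm]
      refine add_le_add ?_ (hP0 x hxh)
      simp only [hη, norm_mul]
      exact mul_le_mul (hT0 _ hkm) (hP0 x hxh) (norm_nonneg _) T0p
    refine (norm_add_le _ _).trans (add_le_add ?_ ?_)
    · rw [norm_mul]; gcongr
    · rw [norm_mul, hL]
      exact mul_le_mul (hB x hxh) h2 (norm_nonneg _) Bp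
  rw [e1, e3]
  refine (intervalIntegral.norm_integral_le_of_norm_le_const bound).trans ?_
  rw [sub_zero, abs_of_nonneg h3p]
  have q1 : ε / (6 * (K + 1)) * (k * K) * (3 / k) ≤ ε / 2 := by
    have : ε / (6 * (K + 1)) * (k * K) * (3 / k) = (ε / 2) * (K / (K + 1)) := by
      field_simp; ring
    rw [this]
    exact mul_le_of_le_one_right (by positivity) ((div_le_one (by positivity)).2 (by linarith))
  have q2 : L * (3 / k) ≤ ε / 2 := by
    rw [div_lt_iff₀ hε] at hkε
    rw [mul_div_assoc', div_le_iff₀ kp]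
    nlinarith
  rw [add_mul]
  linarith

lemma weak_form_of_cutoff_right {h : ℝ} (hh : 0 < h) {F G θ ψ : ℝ → ℂ} (hF : Continuous F)
    (hG : Continuous G) (Fh : F h = 0) (hθ : ContDiff ℝ (⊤ : ℕ∞) θ) (hθ1 : ∀ t, 1 ≤ t → θ t = 1)
    (hψ : ContDiff ℝ (⊤ : ℕ∞) ψ) (ψh : ψ h = 0)
    (H : ∀ k : ℝ, 0 < k → ∫ x in (0 : ℝ)..h,
      (F x * deriv (deriv fun t => θ (k * (h - t) - 1) * ψ t) x
      + G x * (θ (k * (h - x) - 1) * ψ x)) = 0) :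
    ∫ x in (0 : ℝ)..h, (F x * deriv (deriv ψ) x + G x * ψ x) = 0 := by
  have refl2 : ∀ f : ℝ → ℂ, ∀ x, deriv (deriv fun t => f (h - t)) x = deriv (deriv f) (h - x) := by
    intro f x
    have : (deriv fun t => f (h - t)) = fun t => -deriv f (h - t) := by
      funext t; exact deriv_comp_const_sub f h t
    rw [this, deriv.fun_neg, deriv_comp_const_sub (deriv f), neg_neg]
  have key := weak_form_of_cutoff_left hh (F := fun x => F (h - x)) (G := fun x => G (h - x))
    (ψ := fun x => ψ (h - x)) (hF.comp (continuous_const.sub continuous_id))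
    (hG.comp (continuous_const.sub continuous_id)) (by simpa using Fh) hθ hθ1
    (hψ.comp (contDiff_const.sub contDiff_id)) (by simpa using ψh) ?_
  · rw [← key]
    have := intervalIntegral.integral_comp_sub_left (a := 0) (b := h)
      (fun x => F x * deriv (deriv ψ) x + G x * ψ x) h
    rw [sub_self, sub_zero] at this
    rw [← this]
    refine intervalIntegral.integral_congr fun x _ => ?_
    simp only [refl2 ψ]
  · intro k hk
    rw [← H k hk]
    have := intervalIntegral.integral_comp_sub_left (a := 0) (b := h)
      (fun x => F x * deriv (deriv fun t => θ (k * (h - t) - 1) * ψ t) x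
      + G x * (θ (k * (h - x) - 1) * ψ x)) h
    rw [sub_self, sub_zero] at this
    rw [← this]
    refine intervalIntegral.integral_congr fun x _ => ?_
    have := refl2 (fun t => θ (k * (h - t) - 1) * ψ t) x
    simp only [sub_sub_cancel] at this ⊢
    rw [this]

/-- A weak identity `F'' + G = 0` on `(0, h)` with `F` vanishing at the endpoints may be tested
with all smooth functions that vanish at the endpoints. -/
lemma weak_form_of_compactSupport {h : ℝ} (hh : 0 < h) {F G ψ : ℝ → ℂ} (hF : Continuous F)
    (hG : Continuous G) (F0 : F 0 = 0) (Fh : F h = 0)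
    (H : ∀ η : ℝ → ℂ, ContDiff ℝ (⊤ : ℕ∞) η → HasCompactSupport η → tsupport η ⊆ Ioo 0 h →
      ∫ x in (0 : ℝ)..h, (F x * deriv (deriv η) x + G x * η x) = 0)
    (hψ : ContDiff ℝ (⊤ : ℕ∞) ψ) (ψ0 : ψ 0 = 0) (ψh : ψ h = 0) :
    ∫ x in (0 : ℝ)..h, (F x * deriv (deriv ψ) x + G x * ψ x) = 0 := by
  set θ : ℝ → ℂ := fun x => (Real.smoothTransition x : ℂ) with hθdef
  have hθ : ContDiff ℝ (⊤ : ℕ∞) θ :=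
    Complex.ofRealCLM.contDiff.comp Real.smoothTransition.contDiff
  have hθ1 : ∀ t, 1 ≤ t → θ t = 1 := fun t ht => by
    simp [hθdef, Real.smoothTransition.one_of_one_le ht]
  have hθ0 : ∀ t, t ≤ 0 → θ t = 0 := fun t ht => by
    simp [hθdef, Real.smoothTransition.zero_of_nonpos ht]
  refine weak_form_of_cutoff_left hh hF hG F0 hθ hθ1 hψ ψ0 fun k hk => ?_
  have s1 : ContDiff ℝ (⊤ : ℕ∞) fun t => θ (k * t - 1) * ψ t :=
    (hθ.comp ((contDiff_const.mul contDiff_id).sub contDiff_const)).mul hψ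
  refine weak_form_of_cutoff_right hh hF hG Fh hθ hθ1 s1 (by simp [ψh]) fun m hm => ?_
  have s2 : tsupport (fun t => θ (m * (h - t) - 1) * (θ (k * t - 1) * ψ t)) ⊆
      Icc (1 / k) (h - 1 / m) := by
    refine closure_minimal (fun x hx => ?_) isClosed_Icc
    rw [Function.mem_support] at hx
    constructor
    · by_contra! hlt
      rw [lt_div_iff₀ hk] at hlt
      exact hx (by rw [hθ0 (k * x - 1) (by linarith)]; simp)
    · by_contra! hlt
      have : h - x < 1 / m := by linarith
      rw [lt_div_iff₀ hm] at this
      exact hx (by rw [hθ0 (m * (h - x) - 1) (by linarith)]; simp)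
  refine H _ ?_ ?_ ?_
  · exact (hθ.comp ((contDiff_const.mul (contDiff_const.sub contDiff_id)).sub contDiff_const)).mul s1
  · exact HasCompactSupport.of_support_subset_isCompact isCompact_Icc
      (subset_closure.trans s2)
  · refine s2.trans fun x hx => ⟨lt_of_lt_of_le (by positivity) hx.1, lt_of_le_of_lt hx.2 ?_⟩
    have : 0 < 1 / m := by positivity
    linarith

/-- A continuous function on `[0, h]` vanishing at the endpoints is determined by its sine
coefficients. -/
lemma eq_zero_of_sine_coeff_eq_zero {h : ℝ} (hh : 0 < h) {f : ℝ → ℂ} (hf : Continuous f)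
    (f0 : f 0 = 0) (fh : f h = 0)
    (H : ∀ n : ℕ, ∫ x in (0 : ℝ)..h, f x * ((Real.sin (n * π / h * x) : ℝ) : ℂ) = 0) :
    ∀ x ∈ Icc 0 h, f x = 0 := by
  have : Fact (0 < 2 * h) := ⟨by positivity⟩
  have HZ : ∀ n : ℤ, ∫ x in (0 : ℝ)..h, f x * ((Real.sin (n * π / h * x) : ℝ) : ℂ) = 0 := by
    intro n
    obtain ⟨m, rfl | rfl⟩ := n.eq_nat_or_neg
    · exact_mod_cast H m
    · rw [← neg_eq_zero, ← H m, ← intervalIntegral.integral_neg]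
      refine intervalIntegral.integral_congr fun x _ => ?_
      rw [show ((-(m : ℤ) : ℤ) : ℝ) * π / h * x = -(m * π / h * x) by push_cast; ring, Real.sin_neg]
      push_cast
      ring
  set fo : ℝ → ℂ := fun x => if x ≤ 0 then -f (-x) else f x with hfo
  have hfoc : Continuous fo := by
    refine Continuous.if_le (by fun_prop) hf continuous_id continuous_const fun x hx => ?_
    replace hx : x = 0 := hx
    simp [hx, f0]
  have e1 : fo (-h) = fo (-h + 2 * h) := by
    have : ¬ (-h + 2 * h ≤ 0) := by linarith
    simp only [hfo, if_neg this]
    rw [if_pos (by linarith), neg_neg, fh, show -h + 2 * h = h by ring, fh, neg_zero]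
  set F : C(AddCircle (2 * h), ℂ) := ⟨AddCircle.liftIco (2 * h) (-h) fo,
    AddCircle.liftIco_continuous e1 hfoc.continuousOn⟩ with hF
  have coeff : ∀ n : ℤ, fourierCoeff F n = 0 := by
    intro n
    have : fourierCoeff F n = fourierCoeff (AddCircle.liftIco (2 * h) (-h) fo) n := rfl
    rw [this, fourierCoeff_liftIco_eq, fourierCoeffOn_eq_integral, show -h + 2 * h = h by ring]
    convert smul_zero _
    set E : ℝ → ℂ := fun x => fourier (-n) ((x : ℝ) : AddCircle (h - -h)) with hE
    have hEe : ∀ x : ℝ, E x = Complex.exp (-((n * π / h * x : ℝ) : ℂ) * Complex.I) := by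
      intro x
      rw [hE]
      simp only
      rw [fourier_coe_apply]
      congr 1
      push_cast
      have : (h : ℂ) ≠ 0 := by exact_mod_cast hh.ne'
      field_simp
      ring
    have hEc : Continuous E := by
      rw [show E = fun x : ℝ => Complex.exp (-((n * π / h * x : ℝ) : ℂ) * Complex.I) from
        funext hEe]
      fun_prop
    change ∫ x in (-h)..h, E x • fo x = 0
    simp only [smul_eq_mul]
    have hEf : Continuous fun x => E x * fo x := hEc.mul hfoc
    rw [← intervalIntegral.integral_add_adjacent_intervals
      (hEf.intervalIntegrable (-h) 0) (hEf.intervalIntegrable 0 h)]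
    have i1 : ∫ x in (-h)..0, E x * fo x = ∫ x in (0 : ℝ)..h, -(E (-x) * f x) := by
      have := intervalIntegral.integral_comp_neg (a := 0) (b := h) (fun x => E x * fo x)
      rw [neg_zero] at this
      rw [← this]
      refine intervalIntegral.integral_congr fun x hx => ?_
      rw [uIcc_of_le hh.le] at hx
      simp only [hfo]
      rw [if_pos (by linarith [hx.1]), neg_neg]
      ring
    have i2 : ∫ x in (0 : ℝ)..h, E x * fo x = ∫ x in (0 : ℝ)..h, E x * f x := by
      refine intervalIntegral.integral_congr fun x hx => ?_
      rw [uIcc_of_le hh.le] at hx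
      simp only [hfo]
      split_ifs with h0
      · have : x = 0 := le_antisymm h0 hx.1
        simp [this, f0]
      · rfl
    rw [i1, i2, ← intervalIntegral.integral_add]
    · have : ∫ x in (0 : ℝ)..h, (-(E (-x) * f x) + E x * f x) = (-(2 * Complex.I)) *
          ∫ x in (0 : ℝ)..h, f x * ((Real.sin (n * π / h * x) : ℝ) : ℂ) := by
        rw [← intervalIntegral.integral_const_mul]
        refine intervalIntegral.integral_congr fun x _ => ?_
        simp only [hEe]
        rw [Complex.ofReal_sin, Complex.sin]
        rw [show ((n * π / h * -x : ℝ) : ℂ) = -((n * π / h * x : ℝ) : ℂ) by push_cast; ring, neg_neg]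
        linear_combination (f x * (Complex.exp (-((n * π / h * x : ℝ) : ℂ) * Complex.I) -
          Complex.exp (((n * π / h * x : ℝ) : ℂ) * Complex.I))) * Complex.I_sq
      rw [this, HZ, mul_zero]
    · exact (((hEc.comp continuous_neg).mul hf).neg).intervalIntegrable _ _
    · exact (hEc.mul hf).intervalIntegrable _ _
  have hs : Summable (fourierCoeff F) := by
    rw [show fourierCoeff (F : AddCircle (2 * h) → ℂ) = fun _ => 0 from funext coeff]
    exact summable_zero
  have hz : F = 0 := by
    have := hasSum_fourier_series_of_summable hs
    simp only [coeff, zero_smul] at this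
    exact this.unique hasSum_zero
  have hIco : ∀ x ∈ Ico (0 : ℝ) h, f x = 0 := by
    intro x hx
    have hx' : x ∈ Ico (-h) (-h + 2 * h) := ⟨by linarith [hx.1], by linarith [hx.2]⟩
    have h1 : F ((x : ℝ) : AddCircle (2 * h)) = fo x := by
      change AddCircle.liftIco (2 * h) (-h) fo x = fo x
      exact AddCircle.liftIco_coe_apply hx'
    rw [hz] at h1
    rcases hx.1.eq_or_lt with h0 | h0
    · rw [← h0, f0]
    · simp only [hfo, if_neg (not_le.2 h0)] at h1
      exact h1.symm
  intro x hx
  rcases hx.2.eq_or_lt with h0 | h0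
  · rw [h0, fh]
  · exact hIco x ⟨hx.1, h0⟩

/-- The `i`-th derivative of `sin`, evaluated at `nπx/h`. -/
def sinMode (h : ℝ) (i n : ℕ) (x : ℝ) : ℝ := Real.sin (n * π / h * x + i * π / 2)

@[fun_prop]
lemma continuous_sinMode (h : ℝ) (i n : ℕ) : Continuous (sinMode h i n) := by
  unfold sinMode; fun_prop

lemma hasDerivAt_sinMode (h : ℝ) (i n : ℕ) (x : ℝ) :
    HasDerivAt (sinMode h i n) (n * π / h * sinMode h (i + 1) n x) x := by
  have h1 : HasDerivAt (fun y : ℝ => n * π / h * y + i * π / 2) (n * π / h) x := by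
    simpa using ((hasDerivAt_id x).const_mul (n * π / h)).add_const (i * π / 2)
  refine h1.sin.congr_deriv ?_
  simp only [sinMode]
  rw [show n * π / h * x + ((i + 1 : ℕ) : ℝ) * π / 2 = n * π / h * x + i * π / 2 + π / 2 by
    push_cast; ring, Real.sin_add_pi_div_two, mul_comm]

lemma abs_sinMode_le (h : ℝ) (i n : ℕ) (x : ℝ) : |sinMode h i n x| ≤ 1 := Real.abs_sin_le_one _

lemma sinMode_add_two (h : ℝ) (i n : ℕ) (x : ℝ) : sinMode h (i + 2) n x = -sinMode h i n x := by
  simp only [sinMode]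
  rw [← Real.sin_add_pi]
  congr 1
  push_cast
  ring

lemma integral_cos_int {h : ℝ} (hh : 0 < h) {k : ℤ} (hk : k ≠ 0) (j : ℤ) :
    ∫ x in (0 : ℝ)..h, Real.cos (k * π / h * x + j * π) = 0 := by
  have hk' : (k : ℝ) * π / h ≠ 0 := by
    have : (k : ℝ) ≠ 0 := by exact_mod_cast hk
    have := Real.pi_pos
    positivity
  rw [intervalIntegral.integral_comp_mul_add (fun x => Real.cos x) hk', integral_cos]
  have e1 : k * π / h * h + j * π = ((k + j : ℤ) : ℝ) * π := by
    push_cast; field_simp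
  rw [e1, mul_zero, zero_add, Real.sin_int_mul_pi, Real.sin_int_mul_pi]
  simp

lemma integral_sinMode_mul {h : ℝ} (hh : 0 < h) (i : ℕ) {n m : ℕ} (hn : 1 ≤ n) :
    ∫ x in (0 : ℝ)..h, sinMode h i n x * sinMode h i m x = if n = m then h / 2 else 0 := by
  have e : ∀ x, sinMode h i n x * sinMode h i m x =
      (1 / 2) * (Real.cos (((n - m : ℤ) : ℝ) * π / h * x + ((0 : ℤ) : ℝ) * π) -
        Real.cos (((n + m : ℤ) : ℝ) * π / h * x + ((i : ℤ) : ℝ) * π)) := by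
    intro x
    simp only [sinMode]
    rw [show ((n - m : ℤ) : ℝ) * π / h * x + ((0 : ℤ) : ℝ) * π =
      (n * π / h * x + i * π / 2) - (m * π / h * x + i * π / 2) by push_cast; ring,
      show ((n + m : ℤ) : ℝ) * π / h * x + ((i : ℤ) : ℝ) * π =
      (n * π / h * x + i * π / 2) + (m * π / h * x + i * π / 2) by push_cast; ring,
      Real.cos_sub, Real.cos_add (n * π / h * x + i * π / 2)]
    ring
  simp only [e]
  rw [intervalIntegral.integral_const_mul, intervalIntegral.integral_sub
    (Continuous.intervalIntegrable (by fun_prop) _ _)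
    (Continuous.intervalIntegrable (by fun_prop) _ _), integral_cos_int hh (k := n + m) (by omega)]
  split_ifs with hnm
  · subst hnm
    simp
    ring
  · rw [integral_cos_int hh (k := n - m) (by omega)]
    simp

lemma integral_normSq_sum_sinMode {h : ℝ} (hh : 0 < h) (i : ℕ) (F : Finset ℕ)
    (hF : ∀ n ∈ F, 1 ≤ n) (d : ℕ → ℂ) :
    ∫ x in (0 : ℝ)..h, ‖∑ n ∈ F, d n * (sinMode h i n x : ℂ)‖ ^ 2 =
      ∑ n ∈ F, ‖d n‖ ^ 2 * (h / 2) := by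
  have hc := fun n => continuous_sinMode h i n
  apply Complex.ofReal_injective
  rw [← intervalIntegral.integral_ofReal]
  have e : ∀ x, ((‖∑ n ∈ F, d n * (sinMode h i n x : ℂ)‖ ^ 2 : ℝ) : ℂ) =
      ∑ n ∈ F, ∑ m ∈ F, d n * (starRingEnd ℂ) (d m) *
        ((sinMode h i n x * sinMode h i m x : ℝ) : ℂ) := by
    intro x
    rw [Complex.ofReal_pow, ← Complex.mul_conj', map_sum, Finset.sum_mul_sum]
    refine Finset.sum_congr rfl fun n _ => Finset.sum_congr rfl fun m _ => ?_
    rw [map_mul, Complex.conj_ofReal]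
    push_cast
    ring
  simp only [e]
  rw [intervalIntegral.integral_finsetSum
    (fun n _ => Continuous.intervalIntegrable (by fun_prop) _ _)]
  rw [Complex.ofReal_sum]
  refine Finset.sum_congr rfl fun n hn => ?_
  rw [intervalIntegral.integral_finsetSum
    (fun n _ => Continuous.intervalIntegrable (by fun_prop) _ _)]
  simp only [intervalIntegral.integral_const_mul, intervalIntegral.integral_ofReal,
    integral_sinMode_mul hh i (hF n hn)]
  rw [Finset.sum_eq_single n]
  · rw [if_pos rfl, Complex.mul_conj']
    push_cast
    ring
  · intro m _ hm
    rw [if_neg hm.symm]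
    simp
  · exact fun h => absurd hn h

/-- Bessel's inequality for the modes `sinMode h i`. -/
lemma sum_normSq_coeff_le {h : ℝ} (hh : 0 < h) (i : ℕ) (F : Finset ℕ)
    (hF : ∀ n ∈ F, 1 ≤ n) (d : ℕ → ℂ) {f : ℝ → ℂ} (hf : ContinuousOn f (Icc 0 h))
    (hd : ∀ n ∈ F, ∫ x in (0 : ℝ)..h, f x * (sinMode h i n x : ℂ) = d n * ((h / 2 : ℝ) : ℂ)) :
    ∑ n ∈ F, ‖d n‖ ^ 2 * (h / 2) ≤ ∫ x in (0 : ℝ)..h, ‖f x‖ ^ 2 := by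
  have hc := fun n => continuous_sinMode h i n
  rw [← uIcc_of_le hh.le] at hf
  set p : ℝ → ℂ := fun x => ∑ n ∈ F, d n * (sinMode h i n x : ℂ) with hp
  have hpc : Continuous p := by fun_prop
  have hpo := hpc.continuousOn (s := uIcc 0 h)
  have e1 : ∀ x, ‖f x - p x‖ ^ 2 =
      ‖f x‖ ^ 2 - 2 * (f x * (starRingEnd ℂ) (p x)).re + ‖p x‖ ^ 2 := by
    intro x
    simp only [← Complex.normSq_eq_norm_sq]
    rw [Complex.normSq_sub]
    ring
  have cross : ∫ x in (0 : ℝ)..h, f x * (starRingEnd ℂ) (p x) =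
      ((∑ n ∈ F, ‖d n‖ ^ 2 * (h / 2) : ℝ) : ℂ) := by
    have : ∀ x, f x * (starRingEnd ℂ) (p x) =
        ∑ n ∈ F, (starRingEnd ℂ) (d n) * (f x * (sinMode h i n x : ℂ)) := by
      intro x
      simp only [hp]
      rw [map_sum, Finset.mul_sum]
      refine Finset.sum_congr rfl fun n _ => ?_
      rw [map_mul, Complex.conj_ofReal]
      ring
    simp only [this]
    rw [intervalIntegral.integral_finsetSum]
    · rw [Complex.ofReal_sum]
      refine Finset.sum_congr rfl fun n hn => ?_
      rw [intervalIntegral.integral_const_mul, hd n hn, ← mul_assoc, Complex.conj_mul']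
      push_cast
      ring
    · intro n _
      exact (ContinuousOn.mul continuousOn_const (hf.mul
        (by fun_prop : Continuous fun x => (sinMode h i n x : ℂ)).continuousOn)).intervalIntegrable
  have hfp : ContinuousOn (fun x => f x * (starRingEnd ℂ) (p x)) (uIcc 0 h) :=
    hf.mul (Complex.continuous_conj.comp hpc).continuousOn
  have crossre : ∫ x in (0 : ℝ)..h, (f x * (starRingEnd ℂ) (p x)).re =
      ∑ n ∈ F, ‖d n‖ ^ 2 * (h / 2) := by
    have h1 := Complex.reCLM.intervalIntegral_comp_comm
      (hfp.intervalIntegrable (μ := volume))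
    rw [cross] at h1
    exact h1.trans (Complex.ofReal_re _)
  have hre : ContinuousOn (fun x => 2 * (f x * (starRingEnd ℂ) (p x)).re) (uIcc 0 h) :=
    continuousOn_const.mul (Complex.continuous_re.comp_continuousOn hfp)
  have tot : ∫ x in (0 : ℝ)..h, ‖f x - p x‖ ^ 2 =
      (∫ x in (0 : ℝ)..h, ‖f x‖ ^ 2) - ∑ n ∈ F, ‖d n‖ ^ 2 * (h / 2) := by
    simp only [e1]
    rw [intervalIntegral.integral_add, intervalIntegral.integral_sub,
      intervalIntegral.integral_const_mul, crossre, integral_normSq_sum_sinMode hh i F hF d]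
    · ring
    · exact (hf.norm.pow 2).intervalIntegrable
    · exact hre.intervalIntegrable
    · exact ((hf.norm.pow 2).sub hre).intervalIntegrable
    · exact (hpo.norm.pow 2).intervalIntegrable
  have : 0 ≤ ∫ x in (0 : ℝ)..h, ‖f x - p x‖ ^ 2 :=
    intervalIntegral.integral_nonneg hh.le fun x _ => by positivity
  linarith

/-- Repeated integration by parts for functions whose even derivatives vanish at the endpoints. -/
lemma integral_iteratedDerivWithin_mul_sinMode {h : ℝ} (hh : 0 < h) {g : ℝ → ℂ} {M N μ : ℕ}
    (hg : ContDiffOn ℝ M g (Icc 0 h))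
    (g0 : ∀ j < N, iteratedDerivWithin (2 * j) g (Icc 0 h) 0 = 0)
    (gh : ∀ j < N, iteratedDerivWithin (2 * j) g (Icc 0 h) h = 0)
    (hμ : μ ≤ min (2 * N) M) (n : ℕ) :
    ∫ x in (0 : ℝ)..h, iteratedDerivWithin μ g (Icc 0 h) x * (sinMode h μ n x : ℂ) =
      ((n * π / h : ℝ) : ℂ) ^ μ * ∫ x in (0 : ℝ)..h, g x * (sinMode h 0 n x : ℂ) := by
  have hud : UniqueDiffOn ℝ (Icc 0 h) := uniqueDiffOn_Icc hh
  induction μ with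
  | zero => simp
  | succ k ih =>
    rw [le_min_iff] at hμ
    have ih := ih (by rw [le_min_iff]; omega)
    have hcs : ∀ i, Continuous fun x => (sinMode h i n x : ℂ) := fun i =>
      Complex.continuous_ofReal.comp (continuous_sinMode h i n)
    have hc1 : ContinuousOn (iteratedDerivWithin (k + 1) g (Icc 0 h)) (uIcc 0 h) := by
      rw [uIcc_of_le hh.le]
      exact hg.continuousOn_iteratedDerivWithin (by exact_mod_cast hμ.2) hud
    have hc0 : ContinuousOn (iteratedDerivWithin k g (Icc 0 h)) (uIcc 0 h) := by
      rw [uIcc_of_le hh.le]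
      exact hg.continuousOn_iteratedDerivWithin (by exact_mod_cast (by omega : k ≤ M)) hud
    have hder : ∀ x ∈ Ioo (min 0 h) (max 0 h), HasDerivWithinAt (iteratedDerivWithin k g (Icc 0 h))
        (iteratedDerivWithin (k + 1) g (Icc 0 h) x) (Ioi x) x := by
      intro x hx
      rw [min_eq_left hh.le, max_eq_right hh.le] at hx
      have hd := hg.differentiableOn_iteratedDerivWithin (m := k)
        (by exact_mod_cast (by omega : k < M)) hud x (Ioo_subset_Icc_self hx)
      rw [iteratedDerivWithin_succ]
      exact (hd.hasDerivWithinAt.hasDerivAt (Icc_mem_nhds hx.1 hx.2)).hasDerivWithinAt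
    have hder2 : ∀ x ∈ Ioo (min 0 h) (max 0 h), HasDerivWithinAt
        (fun x => (sinMode h (k + 1) n x : ℂ))
        (((n * π / h * sinMode h (k + 2) n x : ℝ)) : ℂ) (Ioi x) x := fun x _ =>
      (hasDerivAt_sinMode h (k + 1) n x).ofReal_comp.hasDerivWithinAt
    have hI2 : IntervalIntegrable (fun x => (((n * π / h * sinMode h (k + 2) n x : ℝ)) : ℂ))
        volume 0 h := by
      have := continuous_sinMode h (k + 2) n
      exact Continuous.intervalIntegrable (by fun_prop) _ _
    have ibp := intervalIntegral.integral_mul_deriv_eq_deriv_mul_of_hasDeriv_right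
      (hcs (k + 1)).continuousOn hc0 hder2 hder hI2
      (hc1.intervalIntegrable (μ := volume))
    have bd : ∀ x : ℝ, (∃ q : ℕ, x = q * h) → (∀ j < N, iteratedDerivWithin (2 * j) g (Icc 0 h) x = 0) →
        (sinMode h (k + 1) n x : ℂ) * iteratedDerivWithin k g (Icc 0 h) x = 0 := by
      rintro x ⟨q, rfl⟩ hx
      rcases Nat.even_or_odd k with ⟨j, hj⟩ | ⟨j, hj⟩
      · rw [hj, ← two_mul, hx j (by omega), mul_zero]
      · have : sinMode h (k + 1) n (q * h) = 0 := by
          simp only [sinMode]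
          rw [show n * π / h * (q * h) + ((k + 1 : ℕ) : ℝ) * π / 2 = ((n * q + j + 1 : ℕ) : ℝ) * π by
            rw [hj]; push_cast; field_simp; ring]
          exact Real.sin_nat_mul_pi _
        rw [this]
        simp
    rw [bd h ⟨1, by simp⟩ gh, bd 0 ⟨0, by simp⟩ g0, sub_zero, zero_sub] at ibp
    rw [pow_succ', mul_assoc, ← ih, ← intervalIntegral.integral_const_mul]
    have : ∫ x in (0 : ℝ)..h, iteratedDerivWithin (k + 1) g (Icc 0 h) x * (sinMode h (k + 1) n x : ℂ) =
        ∫ x in (0 : ℝ)..h, (sinMode h (k + 1) n x : ℂ) * iteratedDerivWithin (k + 1) g (Icc 0 h) x :=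
      intervalIntegral.integral_congr fun x _ => mul_comm _ _
    rw [this, ibp, ← intervalIntegral.integral_neg]
    refine intervalIntegral.integral_congr fun x _ => ?_
    simp only [sinMode_add_two]
    push_cast
    ring

lemma csqrt_sq (r : ℝ) : csqrt r ^ 2 = r := by
  unfold csqrt
  simp [← Complex.cpow_nat_mul]

/-- The factor of `phiHat` depending on the second coordinate. -/
def vMode (κ h1 h2 : ℝ) (n : ℕ) (y : ℝ) : ℂ :=
  Complex.sin ((y : ℂ) * (κ : ℂ) * csqrt (1 - nuHat κ h1 n ^ 2)) /
    Complex.sin ((h2 : ℂ) * (κ : ℂ) * csqrt (1 - nuHat κ h1 n ^ 2))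

lemma mul_nuHat {κ : ℝ} (hκ : 0 < κ) (h1 : ℝ) (n : ℕ) : κ * nuHat κ h1 n = n * π / h1 := by
  unfold nuHat; field_simp

lemma phiHat_eq {κ : ℝ} (hκ : 0 < κ) (h1 h2 : ℝ) (n : ℕ) (p : ℝ × ℝ) :
    phiHat κ h1 h2 n p = (sinMode h1 0 n p.1 : ℂ) * vMode κ h1 h2 n p.2 := by
  simp only [phiHat, vMode, sinMode, mul_nuHat hκ]
  rw [mul_div_assoc]
  push_cast
  simp

lemma contDiff_vMode (κ h1 h2 : ℝ) (n : ℕ) : ContDiff ℝ (⊤ : ℕ∞) (vMode κ h1 h2 n) := by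
  unfold vMode
  have h : ContDiff ℝ (⊤ : ℕ∞) fun y : ℝ => (y : ℂ) := Complex.ofRealCLM.contDiff
  have h2 : ContDiff ℝ (⊤ : ℕ∞) Complex.sin := Complex.contDiff_sin.restrict_scalars ℝ
  exact (h2.comp ((h.mul contDiff_const).mul contDiff_const)).div_const _

lemma deriv_deriv_vMode {κ : ℝ} (hκ : 0 < κ) (h1 h2 : ℝ) (n : ℕ) (y : ℝ) :
    deriv (deriv (vMode κ h1 h2 n)) y = (((n * π / h1) ^ 2 - κ ^ 2 : ℝ) : ℂ) * vMode κ h1 h2 n y := by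
  set c : ℂ := κ * csqrt (1 - nuHat κ h1 n ^ 2) with hc
  have hl : ∀ z : ℂ, HasDerivAt (fun z : ℂ => z * (κ : ℂ) * csqrt (1 - nuHat κ h1 n ^ 2)) c z := by
    intro z
    simpa [hc] using ((hasDerivAt_id z).mul_const (κ : ℂ)).mul_const (csqrt (1 - nuHat κ h1 n ^ 2))
  have e1 : deriv (vMode κ h1 h2 n) = fun y : ℝ =>
      Complex.cos ((y : ℂ) * (κ : ℂ) * csqrt (1 - nuHat κ h1 n ^ 2)) * c /
      Complex.sin ((h2 : ℂ) * (κ : ℂ) * csqrt (1 - nuHat κ h1 n ^ 2)) := by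
    funext y
    exact ((hl y).csin.div_const _).comp_ofReal.deriv
  rw [e1]
  refine (((hl y).ccos.mul_const c).div_const _).comp_ofReal.deriv.trans ?_
  have hc2 : c * c = -(((n * π / h1) ^ 2 - κ ^ 2 : ℝ) : ℂ) := by
    rw [← mul_nuHat hκ, hc]
    have := csqrt_sq (1 - nuHat κ h1 n ^ 2)
    push_cast at this ⊢
    linear_combination (κ : ℂ) ^ 2 * this
  rw [vMode, ← mul_div_assoc]
  congr 1
  linear_combination (-Complex.sin (y * κ * csqrt (1 - nuHat κ h1 n ^ 2))) * hc2

lemma vMode_zero (κ h1 h2 : ℝ) (n : ℕ) : vMode κ h1 h2 n 0 = 0 := by simp [vMode]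

lemma vMode_top {κ h1 h2 : ℝ} (hκ : 0 < κ) (hh2 : 0 < h2)
    (hA0 : A0cond κ h1 h2) (n : ℕ) : vMode κ h1 h2 n h2 = 1 := by
  refine div_self fun h0 => ?_
  obtain ⟨k, hk⟩ := Complex.sin_eq_zero_iff.1 h0
  have hsq : ((h2 * κ) ^ 2 * (1 - nuHat κ h1 n ^ 2) : ℝ) = ((k : ℝ) * π) ^ 2 := by
    apply Complex.ofReal_injective
    have := csqrt_sq (1 - nuHat κ h1 n ^ 2)
    push_cast at this ⊢
    rw [← this, ← hk]
    ring
  apply hA0 n k.natAbs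
  rw [← mul_nuHat hκ]
  have : ((k.natAbs : ℝ)) ^ 2 = (k : ℝ) ^ 2 := by
    rw [Nat.cast_natAbs, Int.cast_abs, sq_abs]
  rw [div_pow, mul_pow ((k.natAbs : ℝ)), this, ← mul_pow (k : ℝ), ← hsq]
  field_simp
  ring

lemma integrableOn_Khat {E : Type*} [NormedAddCommGroup E] (h1 h2 : ℝ) {f : ℝ × ℝ → E}
    (hf : Continuous f) : IntegrableOn f (Khat h1 h2) :=
  (hf.continuousOn.integrableOn_compact (isCompact_Icc.prod isCompact_Icc)).mono_set
    (prod_mono Ioo_subset_Icc_self Ioo_subset_Icc_self)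

lemma setIntegral_Khat {E : Type*} [NormedAddCommGroup E] [NormedSpace ℝ E] {h1 h2 : ℝ}
    (hh1 : 0 < h1) (hh2 : 0 < h2) {f : ℝ × ℝ → E} (hf : IntegrableOn f (Khat h1 h2)) :
    ∫ p in Khat h1 h2, f p = ∫ x in (0 : ℝ)..h1, ∫ y in (0 : ℝ)..h2, f (x, y) := by
  simp only [intervalIntegral.integral_of_le hh1.le, intervalIntegral.integral_of_le hh2.le,
    integral_Ioc_eq_integral_Ioo]
  exact setIntegral_prod f hf

lemma setIntegral_Khat' {E : Type*} [NormedAddCommGroup E] [NormedSpace ℝ E] {h1 h2 : ℝ}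
    (hh1 : 0 < h1) (hh2 : 0 < h2) {f : ℝ × ℝ → E} (hf : IntegrableOn f (Khat h1 h2)) :
    ∫ p in Khat h1 h2, f p = ∫ y in (0 : ℝ)..h2, ∫ x in (0 : ℝ)..h1, f (x, y) := by
  simp only [intervalIntegral.integral_of_le hh1.le, intervalIntegral.integral_of_le hh2.le,
    integral_Ioc_eq_integral_Ioo]
  rw [← MeasureTheory.integral_integral_swap]
  · exact setIntegral_prod f hf
  · rw [Measure.prod_restrict]
    exact hf

lemma hasDerivAt_ofReal_sinMode (h : ℝ) (i n : ℕ) (x : ℝ) :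
    HasDerivAt (fun t => (sinMode h i n t : ℂ))
      (((n * π / h : ℝ) : ℂ) * (sinMode h (i + 1) n x : ℂ)) x := by
  have := (hasDerivAt_sinMode h i n x).ofReal_comp
  rwa [Complex.ofReal_mul] at this

lemma deriv_deriv_sinMode (h : ℝ) (n : ℕ) (x : ℝ) :
    deriv (deriv fun t => (sinMode h 0 n t : ℂ)) x =
      -(((n * π / h) ^ 2 : ℝ) : ℂ) * (sinMode h 0 n x : ℂ) := by
  have e1 : (deriv fun t => (sinMode h 0 n t : ℂ)) =
      fun x => ((n * π / h : ℝ) : ℂ) * (sinMode h 1 n x : ℂ) :=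
    funext fun x => (hasDerivAt_ofReal_sinMode h 0 n x).deriv
  rw [e1, ((hasDerivAt_ofReal_sinMode h 1 n x).const_mul _).deriv, sinMode_add_two]
  push_cast
  ring

lemma contDiff_sinMode (h : ℝ) (i n : ℕ) :
    ContDiff ℝ (⊤ : ℕ∞) fun t => (sinMode h i n t : ℂ) := by
  unfold sinMode
  exact Complex.ofRealCLM.contDiff.comp (Real.contDiff_sin.comp
    ((contDiff_const.mul contDiff_id).add contDiff_const))

lemma sinMode_zero_left (h : ℝ) (n : ℕ) : sinMode h 0 n 0 = 0 := by simp [sinMode]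

lemma sinMode_zero_right {h : ℝ} (hh : 0 < h) (n : ℕ) : sinMode h 0 n h = 0 := by
  simp only [sinMode]
  rw [div_mul_cancel₀ _ hh.ne']
  simp

/-- Separated test functions in the weak Helmholtz equation. -/
lemma weakHelmholtz_separated {κ h1 h2 : ℝ} (hh1 : 0 < h1) (hh2 : 0 < h2) {w : ℝ × ℝ → ℂ}
    (hw : Continuous w) (hweak : WeakHelmholtz κ (Khat h1 h2) w) {η ψ : ℝ → ℂ}
    (hη : ContDiff ℝ (⊤ : ℕ∞) η) (hηs : HasCompactSupport η) (hηt : tsupport η ⊆ Ioo 0 h1)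
    (hψ : ContDiff ℝ (⊤ : ℕ∞) ψ) (hψs : HasCompactSupport ψ) (hψt : tsupport ψ ⊆ Ioo 0 h2) :
    ∫ x in (0 : ℝ)..h1, ((∫ y in (0 : ℝ)..h2, w (x, y) * ψ y) * deriv (deriv η) x +
      (∫ y in (0 : ℝ)..h2, w (x, y) * (deriv (deriv ψ) y + (κ : ℂ) ^ 2 * ψ y)) * η x) = 0 := by
  set φ : ℝ × ℝ → ℂ := fun p => η p.1 * ψ p.2 with hφ
  have hsupp : tsupport φ ⊆ tsupport η ×ˢ tsupport ψ := by
    refine closure_minimal (fun p hp => ?_) ((isClosed_tsupport _).prod (isClosed_tsupport _))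
    have : η p.1 ≠ 0 ∧ ψ p.2 ≠ 0 := by simpa [hφ, Function.mem_support] using hp
    exact ⟨subset_tsupport _ this.1, subset_tsupport _ this.2⟩
  have hz := hweak.2 φ ((hη.comp contDiff_fst).mul (hψ.comp contDiff_snd))
    (HasCompactSupport.of_support_subset_isCompact (hηs.isCompact.prod hψs.isCompact)
      (subset_closure.trans hsupp)) (hsupp.trans (prod_mono hηt hψt))
  have d1 : ∀ p, pdM 2 0 φ p = deriv (deriv η) p.1 * ψ p.2 := by
    intro p
    have : pd1 φ = fun p => deriv η p.1 * ψ p.2 := by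
      funext p
      exact deriv_mul_const_field (ψ p.2)
    change pd1 (pd1 φ) p = _
    rw [this]
    exact deriv_mul_const_field (ψ p.2)
  have d2 : ∀ p, pdM 0 2 φ p = η p.1 * deriv (deriv ψ) p.2 := by
    intro p
    have : pd2 φ = fun p => η p.1 * deriv ψ p.2 := by
      funext p
      exact deriv_const_mul_field (η p.1)
    change pd2 (pd2 φ) p = _
    rw [this]
    exact deriv_const_mul_field (η p.1)
  simp only [d1, d2] at hz
  have cη := hη.continuous
  have cψ := hψ.continuous
  have cη2 : Continuous (deriv (deriv η)) :=
    (contDiff_infty_iff_deriv.1 (contDiff_infty_iff_deriv.1 hη).2).2.continuous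
  have cψ2 : Continuous (deriv (deriv ψ)) :=
    (contDiff_infty_iff_deriv.1 (contDiff_infty_iff_deriv.1 hψ).2).2.continuous
  rw [setIntegral_Khat hh1 hh2 (integrableOn_Khat h1 h2 (by fun_prop))] at hz
  rw [← hz]
  refine intervalIntegral.integral_congr fun x _ => ?_
  simp only
  rw [← intervalIntegral.integral_mul_const, ← intervalIntegral.integral_mul_const,
    ← intervalIntegral.integral_add (Continuous.intervalIntegrable (by fun_prop) _ _)
      (Continuous.intervalIntegrable (by fun_prop) _ _)]
  refine intervalIntegral.integral_congr fun y _ => ?_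
  simp only [hφ]
  ring

/-- Weak form of the ordinary differential equation for the sine coefficients of a weak
Helmholtz solution. -/
lemma weak_ode_sine_coeff {κ h1 h2 : ℝ} (hh1 : 0 < h1) (hh2 : 0 < h2) {w : ℝ × ℝ → ℂ}
    (hw : Continuous w) (w0 : ∀ y, w (0, y) = 0) (w1 : ∀ y, w (h1, y) = 0)
    (hweak : WeakHelmholtz κ (Khat h1 h2) w) (n : ℕ) {ψ : ℝ → ℂ}
    (hψ : ContDiff ℝ (⊤ : ℕ∞) ψ) (hψs : HasCompactSupport ψ) (hψt : tsupport ψ ⊆ Ioo 0 h2) :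
    ∫ y in (0 : ℝ)..h2, (∫ x in (0 : ℝ)..h1, w (x, y) * (sinMode h1 0 n x : ℂ)) *
      (deriv (deriv ψ) y - (((n * π / h1) ^ 2 - κ ^ 2 : ℝ) : ℂ) * ψ y) = 0 := by
  have cψ := hψ.continuous
  have cψ2 : Continuous (deriv (deriv ψ)) :=
    (contDiff_infty_iff_deriv.1 (contDiff_infty_iff_deriv.1 hψ).2).2.continuous
  have cS : Continuous fun x => (sinMode h1 0 n x : ℂ) := (contDiff_sinMode h1 0 n).continuous
  have key := weak_form_of_compactSupport hh1
    (F := fun x => ∫ y in (0 : ℝ)..h2, w (x, y) * ψ y)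
    (G := fun x => ∫ y in (0 : ℝ)..h2, w (x, y) * (deriv (deriv ψ) y + (κ : ℂ) ^ 2 * ψ y))
    (intervalIntegral.continuous_parametric_intervalIntegral_of_continuous' (by fun_prop) _ _)
    (intervalIntegral.continuous_parametric_intervalIntegral_of_continuous' (by fun_prop) _ _)
    (by simp [w0]) (by simp [w1])
    (fun η hη hηs hηt => weakHelmholtz_separated hh1 hh2 hw hweak hη hηs hηt hψ hψs hψt)
    (contDiff_sinMode h1 0 n) (by simp [sinMode_zero_left]) (by simp [sinMode_zero_right hh1])
  have hc : Continuous fun p : ℝ × ℝ => w p * (sinMode h1 0 n p.1 : ℂ) *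
      (deriv (deriv ψ) p.2 - (((n * π / h1) ^ 2 - κ ^ 2 : ℝ) : ℂ) * ψ p.2) := by fun_prop
  have sw := (setIntegral_Khat' hh1 hh2 (integrableOn_Khat h1 h2 hc)).symm.trans
    (setIntegral_Khat hh1 hh2 (integrableOn_Khat h1 h2 hc))
  simp only [intervalIntegral.integral_mul_const] at sw
  rw [sw, ← key]
  refine intervalIntegral.integral_congr fun x _ => ?_
  simp only [deriv_deriv_sinMode]
  rw [← intervalIntegral.integral_mul_const, ← intervalIntegral.integral_mul_const,
    ← intervalIntegral.integral_add (Continuous.intervalIntegrable (by fun_prop) _ _)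
      (Continuous.intervalIntegrable (by fun_prop) _ _)]
  refine intervalIntegral.integral_congr fun y _ => ?_
  push_cast
  ring

lemma weak_ode_vMode {κ h1 h2 : ℝ} (hκ : 0 < κ) (n : ℕ) {ψ : ℝ → ℂ}
    (hψ : ContDiff ℝ (⊤ : ℕ∞) ψ) (hψt : tsupport ψ ⊆ Ioo 0 h2) :
    ∫ y in (0 : ℝ)..h2, vMode κ h1 h2 n y *
      (deriv (deriv ψ) y - (((n * π / h1) ^ 2 - κ ^ 2 : ℝ) : ℂ) * ψ y) = 0 := by
  set V := vMode κ h1 h2 n with hV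
  have sV : ContDiff ℝ (⊤ : ℕ∞) V := contDiff_vMode κ h1 h2 n
  have sdV : ContDiff ℝ (⊤ : ℕ∞) (deriv V) := (contDiff_infty_iff_deriv.1 sV).2
  have sdψ : ContDiff ℝ (⊤ : ℕ∞) (deriv ψ) := (contDiff_infty_iff_deriv.1 hψ).2
  have cψ2 : Continuous (deriv (deriv ψ)) := (contDiff_infty_iff_deriv.1 sdψ).2.continuous
  have cV := sV.continuous
  have cψ := hψ.continuous
  have D : ∀ {f : ℝ → ℂ}, ContDiff ℝ (⊤ : ℕ∞) f → ∀ x, HasDerivAt f (deriv f x) x :=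
    fun hf x => (hf.differentiable (by simp)).differentiableAt.hasDerivAt
  have hder : ∀ y ∈ uIcc 0 h2, HasDerivAt (fun y => V y * deriv ψ y - deriv V y * ψ y)
      (V y * (deriv (deriv ψ) y - (((n * π / h1) ^ 2 - κ ^ 2 : ℝ) : ℂ) * ψ y)) y := by
    intro y _
    refine (((D sV y).mul (D sdψ y)).sub ((D sdV y).mul (D hψ y))).congr_deriv ?_
    rw [hV, deriv_deriv_vMode hκ]
    ring
  rw [intervalIntegral.integral_eq_sub_of_hasDerivAt hder
    (Continuous.intervalIntegrable (by fun_prop) _ _)]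
  have z : ∀ y, y ∉ Ioo 0 h2 → ψ y = 0 ∧ deriv ψ y = 0 := fun y hy =>
    ⟨image_eq_zero_of_notMem_tsupport fun h => hy (hψt h),
      Function.notMem_support.1 fun h => hy (hψt (support_deriv_subset h))⟩
  rw [(z 0 (by simp)).1, (z 0 (by simp)).2, (z h2 (by simp)).1, (z h2 (by simp)).2]
  simp

/-- The sine coefficients of a weak Helmholtz solution vanishing on three sides. -/
lemma sine_coeff_eq {κ h1 h2 : ℝ} (hκ : 0 < κ) (hh1 : 0 < h1) (hh2 : 0 < h2)
    (hA0 : A0cond κ h1 h2) {w : ℝ × ℝ → ℂ}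
    (hw : Continuous w) (w0 : ∀ y, w (0, y) = 0) (w1 : ∀ y, w (h1, y) = 0)
    (wb : ∀ x, w (x, 0) = 0) (hweak : WeakHelmholtz κ (Khat h1 h2) w) (n : ℕ) :
    ∀ y ∈ Icc 0 h2, ∫ x in (0 : ℝ)..h1, w (x, y) * (sinMode h1 0 n x : ℂ) =
      (∫ x in (0 : ℝ)..h1, w (x, h2) * (sinMode h1 0 n x : ℂ)) * vMode κ h1 h2 n y := by
  have cS : Continuous fun x => (sinMode h1 0 n x : ℂ) := (contDiff_sinMode h1 0 n).continuous
  have cV := (contDiff_vMode κ h1 h2 n).continuous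
  set A : ℝ → ℂ := fun y => ∫ x in (0 : ℝ)..h1, w (x, y) * (sinMode h1 0 n x : ℂ) with hA
  have cA : Continuous A :=
    intervalIntegral.continuous_parametric_intervalIntegral_of_continuous' (by fun_prop) _ _
  set D : ℝ → ℂ := fun y => A y - A h2 * vMode κ h1 h2 n y with hD
  have cD : Continuous D := by fun_prop
  have D0 : D 0 = 0 := by simp [hD, hA, wb, vMode_zero]
  have D1 : D h2 = 0 := by simp [hD, vMode_top hκ hh2 hA0]
  set β : ℂ := (((n * π / h1) ^ 2 - κ ^ 2 : ℝ) : ℂ) with hβ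
  have H : ∀ η : ℝ → ℂ, ContDiff ℝ (⊤ : ℕ∞) η → HasCompactSupport η → tsupport η ⊆ Ioo 0 h2 →
      ∫ y in (0 : ℝ)..h2, (D y * deriv (deriv η) y + (-β * D y) * η y) = 0 := by
    intro η hη hηs hηt
    have a1 := weak_ode_sine_coeff hh1 hh2 hw w0 w1 hweak n hη hηs hηt
    have a2 := weak_ode_vMode (κ := κ) (h1 := h1) hκ n hη hηt
    have cη := hη.continuous
    have cη2 : Continuous (deriv (deriv η)) :=
      (contDiff_infty_iff_deriv.1 (contDiff_infty_iff_deriv.1 hη).2).2.continuous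
    have : ∀ y, D y * deriv (deriv η) y + (-β * D y) * η y =
        A y * (deriv (deriv η) y - β * η y) -
          A h2 * (vMode κ h1 h2 n y * (deriv (deriv η) y - β * η y)) := by
      intro y; simp only [hD]; ring
    simp only [this]
    rw [intervalIntegral.integral_sub (Continuous.intervalIntegrable (by fun_prop) _ _)
      (Continuous.intervalIntegrable (by fun_prop) _ _), intervalIntegral.integral_const_mul, a1, a2]
    simp
  have coeff : ∀ m : ℕ, ∫ y in (0 : ℝ)..h2, D y * ((Real.sin (m * π / h2 * y) : ℝ) : ℂ) = 0 := by
    intro m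
    have key := weak_form_of_compactSupport hh2 cD (G := fun y => -β * D y) (by fun_prop) D0 D1 H
      (contDiff_sinMode h2 0 m) (by simp [sinMode_zero_left]) (by simp [sinMode_zero_right hh2])
    have : ∀ y, D y * deriv (deriv fun t => (sinMode h2 0 m t : ℂ)) y +
        -β * D y * (sinMode h2 0 m y : ℂ) =
        (((κ ^ 2 - ((n * π / h1) ^ 2 + (m * π / h2) ^ 2) : ℝ)) : ℂ) *
          (D y * ((Real.sin (m * π / h2 * y) : ℝ) : ℂ)) := by
      intro y
      rw [deriv_deriv_sinMode, hβ]
      simp only [sinMode, Nat.cast_zero, zero_mul, zero_div, add_zero]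
      push_cast
      ring
    simp only [this, intervalIntegral.integral_const_mul] at key
    refine (mul_eq_zero.1 key).resolve_left ?_
    exact Complex.ofReal_ne_zero.2 (sub_ne_zero.2 (hA0 n m))
  intro y hy
  exact sub_eq_zero.1 (eq_zero_of_sine_coeff_eq_zero hh2 cD D0 D1 coeff y hy)

/-- The derivatives of `Real.sinh`, indexed by their order. -/
def hypMode (j : ℕ) (t : ℝ) : ℝ := if Even j then Real.sinh t else Real.cosh t

@[fun_prop]
lemma continuous_hypMode (j : ℕ) : Continuous (hypMode j) := by
  unfold hypMode
  split_ifs <;> fun_prop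

lemma hasDerivAt_hypMode (j : ℕ) (t : ℝ) : HasDerivAt (hypMode j) (hypMode (j + 1) t) t := by
  unfold hypMode
  by_cases h : Even j
  · simpa [h, Nat.even_add_one] using Real.hasDerivAt_sinh t
  · simpa [h, Nat.even_add_one] using Real.hasDerivAt_cosh t

/-- The vertical decay rate of the evanescent modes. -/
def decayRate (κ h1 : ℝ) (n : ℕ) : ℝ := κ * √(nuHat κ h1 n ^ 2 - 1)

lemma vMode_eq_sinh {κ h1 h2 : ℝ} {n : ℕ} (hn : √2 ≤ nuHat κ h1 n) (y : ℝ) :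
    vMode κ h1 h2 n y =
      ((Real.sinh (decayRate κ h1 n * y) / Real.sinh (decayRate κ h1 n * h2) : ℝ) : ℂ) := by
  have h2 : 2 ≤ nuHat κ h1 n ^ 2 := (Real.sqrt_le_iff.1 hn).2
  set s := √(nuHat κ h1 n ^ 2 - 1) with hs
  have hs2 : (s : ℂ) ^ 2 = (nuHat κ h1 n : ℂ) ^ 2 - 1 := by
    exact_mod_cast Real.sq_sqrt (by linarith : 0 ≤ nuHat κ h1 n ^ 2 - 1)
  have hc := csqrt_sq (1 - nuHat κ h1 n ^ 2)
  set c := csqrt (1 - nuHat κ h1 n ^ 2) with hcd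
  have key : ∀ z : ℝ, Complex.sin (z * κ * (s * Complex.I)) =
      (Real.sinh (decayRate κ h1 n * z) : ℂ) * Complex.I := by
    intro z
    rw [decayRate, ← hs, ← mul_assoc, Complex.sin_mul_I]
    push_cast
    congr 2
    ring
  have hprod : (c - s * Complex.I) * (c + s * Complex.I) = 0 := by
    push_cast at hc
    linear_combination hc + hs2 - (s : ℂ) ^ 2 * Complex.I_sq
  rw [vMode, ← hcd]
  push_cast
  rcases mul_eq_zero.1 hprod with h | h
  · rw [sub_eq_zero.1 h, key, key, mul_div_mul_right _ _ Complex.I_ne_zero]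
    push_cast; rfl
  · rw [eq_neg_of_add_eq_zero_left h, mul_neg, mul_neg, Complex.sin_neg, Complex.sin_neg,
      neg_div_neg_eq, key, key, mul_div_mul_right _ _ Complex.I_ne_zero]
    push_cast; rfl

lemma iteratedDeriv_vMode {κ h1 h2 : ℝ} {n : ℕ} (hn : √2 ≤ nuHat κ h1 n) (j : ℕ) (y : ℝ) :
    iteratedDeriv j (vMode κ h1 h2 n) y =
      ((decayRate κ h1 n ^ j * hypMode j (decayRate κ h1 n * y) /
        Real.sinh (decayRate κ h1 n * h2) : ℝ) : ℂ) := by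
  induction j generalizing y with
  | zero => simp [iteratedDeriv_zero, vMode_eq_sinh hn, hypMode]
  | succ j ih =>
    rw [iteratedDeriv_succ, funext ih]
    have h := (((hasDerivAt_hypMode j (decayRate κ h1 n * y)).comp y
      ((hasDerivAt_id y).const_mul (decayRate κ h1 n))).const_mul
        (decayRate κ h1 n ^ j)).div_const (Real.sinh (decayRate κ h1 n * h2))
    refine h.ofReal_comp.deriv.trans ?_
    congr 1
    ring

lemma continuous_iteratedDeriv_vMode (κ h1 h2 : ℝ) (j n : ℕ) :
    Continuous (iteratedDeriv j (vMode κ h1 h2 n)) :=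
  (contDiff_vMode κ h1 h2 n).continuous_iteratedDeriv j (by exact_mod_cast le_top)

lemma hasDerivAt_iteratedDeriv_vMode (κ h1 h2 : ℝ) (j n : ℕ) (y : ℝ) :
    HasDerivAt (iteratedDeriv j (vMode κ h1 h2 n)) (iteratedDeriv (j + 1) (vMode κ h1 h2 n) y) y := by
  rw [iteratedDeriv_succ]
  exact ((contDiff_vMode κ h1 h2 n).differentiable_iteratedDeriv j
    (by exact_mod_cast WithTop.coe_lt_top _)).differentiableAt.hasDerivAt

lemma le_decayRate {κ h1 : ℝ} (hκ : 0 < κ) {n : ℕ} (hn : √2 ≤ nuHat κ h1 n) : κ ≤ decayRate κ h1 n := by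
  have h2 : 2 ≤ nuHat κ h1 n ^ 2 := (Real.sqrt_le_iff.1 hn).2
  exact le_mul_of_one_le_right hκ.le (Real.one_le_sqrt.2 (by linarith))

lemma decayRate_sq {κ h1 : ℝ} {n : ℕ} (hn : √2 ≤ nuHat κ h1 n) :
    decayRate κ h1 n ^ 2 = κ ^ 2 * (nuHat κ h1 n ^ 2 - 1) := by
  have h2 : 2 ≤ nuHat κ h1 n ^ 2 := (Real.sqrt_le_iff.1 hn).2
  rw [decayRate, mul_pow, Real.sq_sqrt (by linarith)]

lemma decayRate_le {κ h1 : ℝ} (hκ : 0 < κ) {n : ℕ} (hn : √2 ≤ nuHat κ h1 n) :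
    decayRate κ h1 n ≤ κ * nuHat κ h1 n := by
  have h0 : 0 ≤ nuHat κ h1 n := (Real.sqrt_nonneg _).trans hn
  refine abs_le_of_sq_le_sq' ?_ (by positivity) |>.2
  rw [decayRate_sq hn]
  nlinarith [sq_nonneg κ]

lemma mul_nuHat_le_decayRate {κ h1 : ℝ} (hκ : 0 < κ) {n : ℕ} (hn : √2 ≤ nuHat κ h1 n) :
    κ * nuHat κ h1 n ≤ √2 * decayRate κ h1 n := by
  have ha := hκ.trans_le (le_decayRate hκ hn)
  refine abs_le_of_sq_le_sq' ?_ (by positivity) |>.2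
  have h2 : 2 ≤ nuHat κ h1 n ^ 2 := (Real.sqrt_le_iff.1 hn).2
  rw [mul_pow, mul_pow, decayRate_sq hn, Real.sq_sqrt (by norm_num)]
  nlinarith [sq_nonneg κ]

lemma integral_hypMode_sq {a h : ℝ} (ha : 0 < a) (j : ℕ) :
    ∫ y in (0 : ℝ)..h, hypMode j (a * y) ^ 2 =
      Real.sinh (a * h) * Real.cosh (a * h) / (2 * a) + (-1) ^ (j + 1) * (h / 2) := by
  have hF : ∀ y, HasDerivAt (fun y => Real.sinh (a * y) * Real.cosh (a * y) / (2 * a) +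
      (-1) ^ (j + 1) * (y / 2)) (hypMode j (a * y) ^ 2) y := by
    intro y
    have hl : HasDerivAt (fun y => a * y) a y := by simpa using (hasDerivAt_id y).const_mul a
    refine (((hl.sinh.mul hl.cosh).div_const (2 * a)).add
      (((hasDerivAt_id y).div_const 2).const_mul ((-1) ^ (j + 1)))).congr_deriv ?_
    have hc := Real.cosh_sq (a * y)
    unfold hypMode
    split_ifs with he
    · rw [he.add_one.neg_one_pow]
      field_simp
      linear_combination hc
    · rw [(Nat.not_even_iff_odd.1 he).add_one.neg_one_pow]
      field_simp
      linear_combination -hc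
  rw [intervalIntegral.integral_eq_sub_of_hasDerivAt (fun y _ => hF y)
    (Continuous.intervalIntegrable (by fun_prop) _ _)]
  simp

lemma mul_le_sinh_mul_cosh {t : ℝ} (ht : 0 ≤ t) : t ≤ Real.sinh t * Real.cosh t :=
  (Real.self_le_sinh_iff.2 ht).trans
    (le_mul_of_one_le_right (Real.sinh_nonneg_iff.2 ht) (Real.one_le_cosh t))

lemma tanh_mono {s t : ℝ} (h : s ≤ t) : Real.tanh s ≤ Real.tanh t := by
  rw [Real.tanh_eq_sinh_div_cosh, Real.tanh_eq_sinh_div_cosh,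
    div_le_div_iff₀ (Real.cosh_pos _) (Real.cosh_pos _)]
  have := Real.sinh_nonneg_iff.2 (sub_nonneg.2 h)
  rw [Real.sinh_sub] at this
  linarith

lemma norm_iteratedDeriv_vMode_sq {κ h1 h2 : ℝ} {n : ℕ} (hn : √2 ≤ nuHat κ h1 n) (j : ℕ) (y : ℝ) :
    ‖iteratedDeriv j (vMode κ h1 h2 n) y‖ ^ 2 =
      decayRate κ h1 n ^ (2 * j) / Real.sinh (decayRate κ h1 n * h2) ^ 2 *
        hypMode j (decayRate κ h1 n * y) ^ 2 := by
  rw [iteratedDeriv_vMode hn, Complex.norm_real, Real.norm_eq_abs, sq_abs]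
  ring

lemma integral_norm_iteratedDeriv_vMode_sq_le {κ h1 h2 : ℝ} (hκ : 0 < κ) (hh2 : 0 < h2) {n : ℕ}
    (hn : √2 ≤ nuHat κ h1 n) (j : ℕ) :
    ∫ y in (0 : ℝ)..h2, ‖iteratedDeriv j (vMode κ h1 h2 n) y‖ ^ 2 ≤
      (κ * nuHat κ h1 n) ^ (2 * j) * (√2 / (κ * nuHat κ h1 n * Real.tanh (κ * h2))) := by
  have hκa := le_decayRate hκ hn
  have hal := decayRate_le hκ hn
  have hla := mul_nuHat_le_decayRate hκ hn
  simp only [norm_iteratedDeriv_vMode_sq hn, intervalIntegral.integral_const_mul]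
  set a := decayRate κ h1 n
  have ha : 0 < a := hκ.trans_le hκa
  have hT : 0 < Real.tanh (κ * h2) := by
    rw [Real.tanh_eq_sinh_div_cosh]
    exact div_pos (Real.sinh_pos_iff.2 (by positivity)) (Real.cosh_pos _)
  have hTa : Real.tanh (κ * h2) ≤ Real.tanh (a * h2) := tanh_mono (by gcongr)
  have hS : 0 < Real.sinh (a * h2) := Real.sinh_pos_iff.2 (by positivity)
  have hC := Real.cosh_pos (a * h2)
  have hl : 0 < κ * nuHat κ h1 n := ha.trans_le hal
  have hI : ∫ y in (0 : ℝ)..h2, hypMode j (a * y) ^ 2 ≤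
      Real.sinh (a * h2) * Real.cosh (a * h2) / a := by
    rw [integral_hypMode_sq ha]
    have h1 : (-1 : ℝ) ^ (j + 1) * (h2 / 2) ≤ h2 / 2 := by
      rcases neg_one_pow_eq_or ℝ (j + 1) with h | h <;> rw [h] <;> linarith
    have h2' : h2 / 2 ≤ Real.sinh (a * h2) * Real.cosh (a * h2) / (2 * a) := by
      rw [div_le_div_iff₀ (by norm_num) (by positivity)]
      nlinarith [mul_le_sinh_mul_cosh (t := a * h2) (by positivity)]
    have h3 : Real.sinh (a * h2) * Real.cosh (a * h2) / a =
      2 * (Real.sinh (a * h2) * Real.cosh (a * h2) / (2 * a)) := by field_simp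
    linarith
  calc _ ≤ a ^ (2 * j) / Real.sinh (a * h2) ^ 2 * (Real.sinh (a * h2) * Real.cosh (a * h2) / a) := by
        gcongr
    _ = a ^ (2 * j) * (1 / (a * Real.tanh (a * h2))) := by
        rw [Real.tanh_eq_sinh_div_cosh]
        field_simp
    _ ≤ (κ * nuHat κ h1 n) ^ (2 * j) * (√2 / (κ * nuHat κ h1 n * Real.tanh (κ * h2))) := by
        have hTa' := hT.trans_le hTa
        refine mul_le_mul (by gcongr) ?_ (by positivity) (by positivity)
        · rw [div_le_div_iff₀ (mul_pos ha (hT.trans_le hTa)) (by positivity), one_mul, ← mul_assoc]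
          gcongr

/-- The vertical energy of an evanescent mode is bounded below. -/
lemma le_integral_norm_deriv_vMode_sq {κ h1 h2 : ℝ} (hκ : 0 < κ) (hh2 : 0 < h2) {n : ℕ}
    (hn : √2 ≤ nuHat κ h1 n) :
    κ / 2 ≤ ∫ y in (0 : ℝ)..h2, ‖iteratedDeriv 1 (vMode κ h1 h2 n) y‖ ^ 2 := by
  have hκa := le_decayRate hκ hn
  simp only [norm_iteratedDeriv_vMode_sq hn, intervalIntegral.integral_const_mul]
  set a := decayRate κ h1 n
  have ha : 0 < a := hκ.trans_le hκa
  have hS : 0 < Real.sinh (a * h2) := Real.sinh_pos_iff.2 (by positivity)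
  have hSC := Real.sinh_lt_cosh (a * h2)
  calc κ / 2 ≤ a / 2 := by linarith
    _ = a ^ (2 * 1) / Real.sinh (a * h2) ^ 2 * (Real.sinh (a * h2) * Real.sinh (a * h2) / (2 * a)) := by
        field_simp
    _ ≤ _ := by
        rw [integral_hypMode_sq ha]
        gcongr
        have : Real.sinh (a * h2) * Real.sinh (a * h2) / (2 * a) ≤
          Real.sinh (a * h2) * Real.cosh (a * h2) / (2 * a) := by gcongr
        norm_num
        linarith

lemma abs_hypMode_le_exp (j : ℕ) {t : ℝ} (ht : 0 ≤ t) : |hypMode j t| ≤ Real.exp t := by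
  have h1 := Real.cosh_add_sinh t
  have h2 := Real.sinh_nonneg_iff.2 ht
  have h3 := Real.cosh_pos t
  unfold hypMode
  split_ifs
  · rw [abs_of_nonneg h2]; linarith
  · rw [abs_of_pos h3]; linarith

lemma exp_mul_le_sinh {s t : ℝ} (h : s ≤ t) :
    Real.exp t * ((1 - Real.exp (-(2 * s))) / 2) ≤ Real.sinh t := by
  rw [Real.sinh_eq]
  have : Real.exp (-t) ≤ Real.exp t * Real.exp (-(2 * s)) := by
    rw [← Real.exp_add]
    exact Real.exp_le_exp.2 (by linarith)
  linarith

lemma norm_iteratedDeriv_vMode_le {κ h1 h2 : ℝ} (hκ : 0 < κ) (hh2 : 0 < h2) {n : ℕ}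
    (hn : √2 ≤ nuHat κ h1 n) (j : ℕ) {y y' : ℝ} (hy0 : 0 ≤ y) (hy : y ≤ y') (hy' : y' ≤ h2) :
    ‖iteratedDeriv j (vMode κ h1 h2 n) y‖ ≤
      ((1 - Real.exp (-(2 * (κ * h2)))) / 2)⁻¹ * ((κ * nuHat κ h1 n) ^ j *
        Real.exp (-(κ * nuHat κ h1 n * ((h2 - y') / √2)))) := by
  have hκa := le_decayRate hκ hn
  have hal := decayRate_le hκ hn
  have hla := mul_nuHat_le_decayRate hκ hn
  rw [iteratedDeriv_vMode hn, Complex.norm_real, Real.norm_eq_abs]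
  set a := decayRate κ h1 n
  have ha : 0 < a := hκ.trans_le hκa
  have hS : 0 < Real.sinh (a * h2) := Real.sinh_pos_iff.2 (by positivity)
  have hc : 0 < (1 - Real.exp (-(2 * (κ * h2)))) / 2 := by
    have : Real.exp (-(2 * (κ * h2))) < 1 := Real.exp_lt_one_iff.2 (by simp; positivity)
    linarith
  have hsinh := exp_mul_le_sinh (s := κ * h2) (t := a * h2) (by gcongr)
  set c := (1 - Real.exp (-(2 * (κ * h2)))) / 2
  rw [abs_div, abs_mul, abs_of_nonneg (by positivity : 0 ≤ a ^ j), abs_of_pos hS]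
  have hb := (abs_hypMode_le_exp j (mul_nonneg ha.le hy0)).trans
    (Real.exp_le_exp.2 (mul_le_mul_of_nonneg_left hy ha.le))
  have h2' : Real.exp (a * y') = Real.exp (a * h2) * Real.exp (-(a * (h2 - y'))) := by
    rw [← Real.exp_add]; congr 1; ring
  have h3 : κ * nuHat κ h1 n * ((h2 - y') / √2) ≤ a * (h2 - y') := by
    rw [← mul_div_assoc, div_le_iff₀ (by positivity)]
    have hl := ha.trans_le hal
    nlinarith [mul_le_mul_of_nonneg_right hla (sub_nonneg.2 hy')]
  calc a ^ j * |hypMode j (a * y)| / Real.sinh (a * h2)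
      ≤ a ^ j * (Real.exp (a * h2) * Real.exp (-(a * (h2 - y')))) / (Real.exp (a * h2) * c) := by
        rw [h2'] at hb
        gcongr
    _ = c⁻¹ * (a ^ j * Real.exp (-(a * (h2 - y')))) := by field_simp
    _ ≤ _ := by
        have hl := ha.trans_le hal
        gcongr c⁻¹ * (?_ ^ j * Real.exp (-?_))

/-- Uniformly on compact subsets away from the top edge, the modes and all their derivatives are
dominated by a summable sequence. -/
lemma exists_summable_bound_vMode {κ h1 h2 : ℝ} (hκ : 0 < κ) (hh1 : 0 < h1) (hh2 : 0 < h2)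
    (i j : ℕ) {y' : ℝ} (hy' : y' < h2) :
    ∃ c : ℕ → ℝ, Summable c ∧ (∀ n, 0 ≤ c n) ∧ ∀ n, ∀ y ∈ Icc 0 y',
      (n * π / h1) ^ i * ‖iteratedDeriv j (vMode κ h1 h2 n) y‖ ≤ c n := by
  have hK : ∀ n, ∃ K, 0 ≤ K ∧ ∀ y ∈ Icc 0 y',
      (n * π / h1) ^ i * ‖iteratedDeriv j (vMode κ h1 h2 n) y‖ ≤ K := by
    intro n
    obtain ⟨K, hK⟩ := isCompact_Icc.exists_bound_of_continuousOn (s := Icc 0 y')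
      (continuous_iteratedDeriv_vMode κ h1 h2 j n).continuousOn
    refine ⟨(n * π / h1) ^ i * |K|, by positivity, fun y hy => ?_⟩
    gcongr
    exact (hK y hy).trans (le_abs_self K)
  choose K hK0 hK using hK
  set q := Real.exp (-(π / h1 * ((h2 - y') / √2))) with hq
  have hq1 : q < 1 := Real.exp_lt_one_iff.2 (by
    have := sub_pos.2 hy'
    have : 0 < π / h1 * ((h2 - y') / √2) := by positivity
    linarith)
  set C := ((1 - Real.exp (-(2 * (κ * h2)))) / 2)⁻¹ with hC
  have hC0 : 0 ≤ C := by
    have : Real.exp (-(2 * (κ * h2))) < 1 := Real.exp_lt_one_iff.2 (by simp; positivity)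
    exact inv_nonneg.2 (by linarith)
  have hs := summable_pow_mul_geometric_of_norm_lt_one (i + j)
    (by rwa [Real.norm_of_nonneg (Real.exp_pos _).le] : ‖q‖ < 1)
  have hfin : {n : ℕ | ¬ √2 ≤ nuHat κ h1 n}.Finite := by
    obtain ⟨m, hm⟩ := exists_nat_ge (√2 * (κ * h1) / π)
    refine (Set.finite_lt_nat m).subset fun n hn => ?_
    by_contra hnm
    refine hn ?_
    rw [nuHat, le_div_iff₀ (by positivity)]
    rw [div_le_iff₀ Real.pi_pos] at hm
    refine hm.trans ?_
    have : (m : ℝ) ≤ n := by exact_mod_cast not_lt.1 hnm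
    gcongr
  refine ⟨fun n => C * (π / h1) ^ (i + j) * ((n : ℝ) ^ (i + j) * q ^ n) +
    if √2 ≤ nuHat κ h1 n then 0 else K n, (hs.mul_left _).add ?_, fun n => ?_, fun n y hy => ?_⟩
  · refine summable_of_hasFiniteSupport (hfin.subset fun n hn => ?_)
    by_contra h
    simp only [mem_ofPred_eq, not_not] at h
    simp [h] at hn
  · have := hK0 n
    have := (Real.exp_pos (-(π / h1 * ((h2 - y') / √2)))).le
    dsimp only
    split_ifs <;> positivity
  · have hqp : 0 ≤ q := (Real.exp_pos _).le
    by_cases hn : √2 ≤ nuHat κ h1 n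
    · have h := norm_iteratedDeriv_vMode_le (h1 := h1) hκ hh2 hn j hy.1 hy.2 hy'.le
      rw [mul_nuHat hκ] at h
      have e : Real.exp (-(n * π / h1 * ((h2 - y') / √2))) = q ^ n := by
        rw [hq, ← Real.exp_nat_mul]; congr 1; ring
      rw [e] at h
      simp only [hn, if_true, add_zero]
      calc _ ≤ (n * π / h1) ^ i * (C * ((n * π / h1) ^ j * q ^ n)) := by gcongr
        _ = _ := by rw [mul_div_assoc, mul_pow, mul_pow]; ring
    · simp only [hn, if_false]
      exact (hK n y hy).trans (le_add_of_nonneg_left (by positivity))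

/-- The `n`-th term of a differentiated series of modes. -/
def modeTerm (κ h1 h2 : ℝ) (b : ℕ → ℂ) (i j n : ℕ) (p : ℝ × ℝ) : ℂ :=
  b n * (((n * π / h1 : ℝ) : ℂ) ^ i * (sinMode h1 i n p.1 : ℂ)) *
    iteratedDeriv j (vMode κ h1 h2 n) p.2

/-- The series of modes with coefficients `b`, formally differentiated `i` times in the first
coordinate and `j` times in the second. -/
def modeSeries (κ h1 h2 : ℝ) (b : ℕ → ℂ) (i j : ℕ) (p : ℝ × ℝ) : ℂ :=
  ∑' n, modeTerm κ h1 h2 b i j n p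

section modeSeries

variable {κ h1 h2 : ℝ}

lemma continuous_modeTerm (κ h1 h2 : ℝ) (b : ℕ → ℂ) (i j n : ℕ) :
    Continuous (modeTerm κ h1 h2 b i j n) := by
  have := continuous_iteratedDeriv_vMode κ h1 h2 j n
  unfold modeTerm
  fun_prop

lemma hasDerivAt_modeTerm_fst (κ h1 h2 : ℝ) (b : ℕ → ℂ) (i j n : ℕ) (x y : ℝ) :
    HasDerivAt (fun t => modeTerm κ h1 h2 b i j n (t, y))
      (modeTerm κ h1 h2 b (i + 1) j n (x, y)) x := by
  refine ((((hasDerivAt_ofReal_sinMode h1 i n x).const_mul _).const_mul (b n)).mul_const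
    (iteratedDeriv j (vMode κ h1 h2 n) y)).congr_deriv ?_
  simp only [modeTerm]
  ring

lemma hasDerivAt_modeTerm_snd (κ h1 h2 : ℝ) (b : ℕ → ℂ) (i j n : ℕ) (x y : ℝ) :
    HasDerivAt (fun t => modeTerm κ h1 h2 b i j n (x, t))
      (modeTerm κ h1 h2 b i (j + 1) n (x, y)) y :=
  (hasDerivAt_iteratedDeriv_vMode κ h1 h2 j n y).const_mul
    (b n * (((n * π / h1 : ℝ) : ℂ) ^ i * (sinMode h1 i n x : ℂ)))

lemma norm_modeTerm_le (hh1 : 0 < h1) {b : ℕ → ℂ} {B : ℝ} (hb : ∀ n, ‖b n‖ ≤ B) (i j n : ℕ)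
    (p : ℝ × ℝ) : ‖modeTerm κ h1 h2 b i j n p‖ ≤
      B * ((n * π / h1) ^ i * ‖iteratedDeriv j (vMode κ h1 h2 n) p.2‖) := by
  have h0 : 0 ≤ n * π / h1 := by positivity
  rw [modeTerm, norm_mul, norm_mul, norm_mul, norm_pow, Complex.norm_real, Complex.norm_real,
    Real.norm_of_nonneg h0, Real.norm_eq_abs]
  have h1' := abs_sinMode_le h1 i n p.1
  have hB : 0 ≤ B := (norm_nonneg _).trans (hb n)
  rw [mul_assoc]
  refine mul_le_mul (hb n) ?_ (by positivity) hB
  exact mul_le_mul_of_nonneg_right (mul_le_of_le_one_right (by positivity) h1') (norm_nonneg _)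

lemma exists_summable_bound_modeTerm (hκ : 0 < κ) (hh1 : 0 < h1) (hh2 : 0 < h2) {b : ℕ → ℂ}
    {B : ℝ} (hb : ∀ n, ‖b n‖ ≤ B) (i j : ℕ) {y' : ℝ} (hy' : y' < h2) :
    ∃ c : ℕ → ℝ, Summable c ∧ ∀ n, ∀ p : ℝ × ℝ, p.2 ∈ Icc 0 y' →
      ‖modeTerm κ h1 h2 b i j n p‖ ≤ c n := by
  obtain ⟨c, hc, -, hcb⟩ := exists_summable_bound_vMode (h1 := h1) hκ hh1 hh2 i j hy'
  have hB : 0 ≤ B := (norm_nonneg _).trans (hb 0)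
  refine ⟨fun n => B * c n, hc.mul_left B, fun n p hp => ?_⟩
  exact (norm_modeTerm_le hh1 hb i j n p).trans (mul_le_mul_of_nonneg_left (hcb n _ hp) hB)

lemma summable_modeTerm (hκ : 0 < κ) (hh1 : 0 < h1) (hh2 : 0 < h2) {b : ℕ → ℂ} {B : ℝ}
    (hb : ∀ n, ‖b n‖ ≤ B) (i j : ℕ) {p : ℝ × ℝ} (hp : p.2 ∈ Ico 0 h2) :
    Summable fun n => modeTerm κ h1 h2 b i j n p := by
  obtain ⟨c, hc, hcb⟩ := exists_summable_bound_modeTerm hκ hh1 hh2 hb i j hp.2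
  exact .of_norm_bounded hc fun n => hcb n p ⟨hp.1, le_rfl⟩

lemma hasDerivAt_modeSeries_fst (hκ : 0 < κ) (hh1 : 0 < h1) (hh2 : 0 < h2) {b : ℕ → ℂ} {B : ℝ}
    (hb : ∀ n, ‖b n‖ ≤ B) (i j : ℕ) (x : ℝ) {y : ℝ} (hy : y ∈ Ioo 0 h2) :
    HasDerivAt (fun t => modeSeries κ h1 h2 b i j (t, y))
      (modeSeries κ h1 h2 b (i + 1) j (x, y)) x := by
  obtain ⟨c, hc, hcb⟩ := exists_summable_bound_modeTerm hκ hh1 hh2 hb (i + 1) j hy.2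
  exact hasDerivAt_tsum_of_isPreconnected hc isOpen_univ isPreconnected_univ
    (fun n t _ => hasDerivAt_modeTerm_fst κ h1 h2 b i j n t y)
    (fun n t _ => hcb n (t, y) ⟨hy.1.le, le_rfl⟩) (mem_univ x)
    (summable_modeTerm hκ hh1 hh2 hb i j ⟨hy.1.le, hy.2⟩) (mem_univ x)

lemma hasDerivAt_modeSeries_snd (hκ : 0 < κ) (hh1 : 0 < h1) (hh2 : 0 < h2) {b : ℕ → ℂ} {B : ℝ}
    (hb : ∀ n, ‖b n‖ ≤ B) (i j : ℕ) (x : ℝ) {y : ℝ} (hy : y ∈ Ioo 0 h2) :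
    HasDerivAt (fun t => modeSeries κ h1 h2 b i j (x, t))
      (modeSeries κ h1 h2 b i (j + 1) (x, y)) y := by
  obtain ⟨y', hyy', hy'⟩ := exists_between hy.2
  obtain ⟨c, hc, hcb⟩ := exists_summable_bound_modeTerm hκ hh1 hh2 hb i (j + 1) hy'
  exact hasDerivAt_tsum_of_isPreconnected hc isOpen_Ioo (t := Ioo 0 y') isPreconnected_Ioo
    (fun n t _ => hasDerivAt_modeTerm_snd κ h1 h2 b i j n x t)
    (fun n t ht => hcb n (x, t) (Ioo_subset_Icc_self ht)) ⟨hy.1, hyy'⟩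
    (summable_modeTerm hκ hh1 hh2 hb i j ⟨hy.1.le, hy.2⟩) ⟨hy.1, hyy'⟩

/-- On the rectangle, partial derivatives of a series of modes may be computed termwise. -/
lemma pdM_eq_modeSeries (hκ : 0 < κ) (hh1 : 0 < h1) (hh2 : 0 < h2) {b : ℕ → ℂ} {B : ℝ}
    (hb : ∀ n, ‖b n‖ ≤ B) {f : ℝ × ℝ → ℂ} (hf : EqOn f (modeSeries κ h1 h2 b 0 0) (Khat h1 h2))
    (i j : ℕ) : EqOn (pdM i j f) (modeSeries κ h1 h2 b i j) (Khat h1 h2) := by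
  have step2 : EqOn (pd2^[j] f) (modeSeries κ h1 h2 b 0 j) (Khat h1 h2) := by
    induction j with
    | zero => exact hf
    | succ j ih =>
      rintro ⟨x, y⟩ ⟨hx, hy⟩
      rw [Function.iterate_succ_apply']
      refine (Filter.EventuallyEq.deriv_eq ?_).trans
        (hasDerivAt_modeSeries_snd hκ hh1 hh2 hb 0 j x hy).deriv
      filter_upwards [isOpen_Ioo.mem_nhds hy] with t ht using ih ⟨hx, ht⟩
  induction i with
  | zero => exact step2
  | succ i ih =>
    rintro ⟨x, y⟩ ⟨hx, hy⟩
    rw [pdM, Function.iterate_succ_apply']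
    refine (Filter.EventuallyEq.deriv_eq ?_).trans
      (hasDerivAt_modeSeries_fst hκ hh1 hh2 hb i j x hy).deriv
    filter_upwards [isOpen_Ioo.mem_nhds hx] with t ht using ih ⟨ht, hy⟩

end modeSeries

lemma continuous_modeSeries_fst {κ h1 h2 : ℝ} (hκ : 0 < κ) (hh1 : 0 < h1) (hh2 : 0 < h2)
    {b : ℕ → ℂ} {B : ℝ} (hb : ∀ n, ‖b n‖ ≤ B) (i j : ℕ) {y : ℝ} (hy : y ∈ Ioo 0 h2) :
    Continuous fun x => modeSeries κ h1 h2 b i j (x, y) :=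
  continuous_iff_continuousAt.2 fun x =>
    (hasDerivAt_modeSeries_fst hκ hh1 hh2 hb i j x hy).continuousAt

/-- The Fourier coefficients of the horizontal slices of a series of modes. -/
lemma integral_modeSeries_mul_sinMode {κ h1 h2 : ℝ} (hκ : 0 < κ) (hh1 : 0 < h1) (hh2 : 0 < h2)
    {b : ℕ → ℂ} {B : ℝ} (hb : ∀ n, ‖b n‖ ≤ B) (i j : ℕ) {m : ℕ} (hm : 1 ≤ m) {y : ℝ}
    (hy : y ∈ Ioo 0 h2) :
    ∫ x in (0 : ℝ)..h1, modeSeries κ h1 h2 b i j (x, y) * (sinMode h1 i m x : ℂ) =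
      b m * ((m * π / h1 : ℝ) : ℂ) ^ i * iteratedDeriv j (vMode κ h1 h2 m) y *
        ((h1 / 2 : ℝ) : ℂ) := by
  obtain ⟨c, hc, hcb⟩ := exists_summable_bound_modeTerm hκ hh1 hh2 hb i j hy.2
  have hS := fun k => (contDiff_sinMode h1 i k).continuous
  have hsum : HasSum
      (fun n => ∫ x in (0 : ℝ)..h1, modeTerm κ h1 h2 b i j n (x, y) * (sinMode h1 i m x : ℂ))
      (∫ x in (0 : ℝ)..h1, modeSeries κ h1 h2 b i j (x, y) * (sinMode h1 i m x : ℂ)) := by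
    refine intervalIntegral.hasSum_integral_of_dominated_convergence (fun n _ => c n)
      (fun n => ?_) (fun n => ?_) (.of_forall fun _ _ => hc) ?_ (.of_forall fun x _ => ?_)
    · have := continuous_modeTerm κ h1 h2 b i j n
      have := hS m
      exact Continuous.aestronglyMeasurable (by fun_prop)
    · refine .of_forall fun x _ => ?_
      rw [norm_mul, Complex.norm_real]
      exact (mul_le_of_le_one_right (norm_nonneg _) (abs_sinMode_le h1 i m x)).trans
        (hcb n (x, y) ⟨hy.1.le, le_rfl⟩)
    · simp
    · exact (summable_modeTerm hκ hh1 hh2 hb i j (p := (x, y)) ⟨hy.1.le, hy.2⟩).hasSum.mul_right _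
  have hterm : ∀ n,
      ∫ x in (0 : ℝ)..h1, modeTerm κ h1 h2 b i j n (x, y) * (sinMode h1 i m x : ℂ) =
      if n = m then b m * ((m * π / h1 : ℝ) : ℂ) ^ i * iteratedDeriv j (vMode κ h1 h2 m) y *
        ((h1 / 2 : ℝ) : ℂ) else 0 := by
    intro n
    have e : ∀ x, modeTerm κ h1 h2 b i j n (x, y) * (sinMode h1 i m x : ℂ) =
        b n * ((n * π / h1 : ℝ) : ℂ) ^ i * iteratedDeriv j (vMode κ h1 h2 n) y *
          ((sinMode h1 i m x * sinMode h1 i n x : ℝ) : ℂ) := by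
      intro x
      simp only [modeTerm]
      push_cast
      ring
    simp only [e]
    rw [intervalIntegral.integral_const_mul, intervalIntegral.integral_ofReal,
      integral_sinMode_mul hh1 i hm]
    by_cases h : m = n
    · subst h; simp
    · simp [h, Ne.symm h]
  rw [← hsum.tsum_eq]
  simp only [hterm, tsum_ite_eq]

/-- Sine coefficients of a function on `[0, h]`. -/
def sineCoeff (h : ℝ) (g : ℝ → ℂ) (n : ℕ) : ℂ :=
  ((2 / h : ℝ) : ℂ) * ∫ x in (0 : ℝ)..h, g x * (sinMode h 0 n x : ℂ)

lemma exists_norm_sineCoeff_le {h : ℝ} (hh : 0 < h) {g : ℝ → ℂ} (hg : ContinuousOn g (Icc 0 h)) :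
    ∃ B, ∀ n, ‖sineCoeff h g n‖ ≤ B := by
  obtain ⟨K, hK⟩ := isCompact_Icc.exists_bound_of_continuousOn hg
  refine ⟨2 / h * (K * |h - 0|), fun n => ?_⟩
  rw [sineCoeff, norm_mul, Complex.norm_real, Real.norm_of_nonneg (by positivity)]
  refine mul_le_mul_of_nonneg_left ?_ (by positivity)
  refine intervalIntegral.norm_integral_le_of_norm_le_const fun x hx => ?_
  rw [uIoc_of_le hh.le] at hx
  rw [norm_mul, Complex.norm_real]
  exact (mul_le_of_le_one_right (norm_nonneg _) (abs_sinMode_le h 0 n x)).trans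
    (hK x (Ioc_subset_Icc_self hx))

lemma integral_mul_sinMode_eq_sineCoeff {h : ℝ} (hh : 0 < h) (g : ℝ → ℂ) (n : ℕ) :
    ∫ x in (0 : ℝ)..h, g x * (sinMode h 0 n x : ℂ) = sineCoeff h g n * ((h / 2 : ℝ) : ℂ) := by
  rw [sineCoeff]
  have : (h : ℂ) ≠ 0 := by exact_mod_cast hh.ne'
  push_cast
  field_simp

/-- A function in the local Helmholtz space is the sum of the modes, weighted with the sine
coefficients of its trace. -/
lemma SLoc.eqOn_modeSeries {κ h1 h2 : ℝ} (hκ : 0 < κ) (hh1 : 0 < h1) (hh2 : 0 < h2)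
    (hA0 : A0cond κ h1 h2) {N M : ℕ} {u : ℝ × ℝ → ℂ} (hu : SLoc κ h1 h2 N M u) :
    EqOn u (modeSeries κ h1 h2 (sineCoeff h1 (traceTop h2 u)) 0 0) (Khat h1 h2) := by
  set b := sineCoeff h1 (traceTop h2 u) with hbdef
  have hg : ContinuousOn (traceTop h2 u) (Icc 0 h1) :=
    hu.cont.comp (by fun_prop) fun x hx => ⟨hx, hh2.le, le_rfl⟩
  obtain ⟨B, hB⟩ := exists_norm_sineCoeff_le hh1 hg
  set w : ℝ × ℝ → ℂ := fun p => u (projIcc 0 h1 hh1.le p.1, projIcc 0 h2 hh2.le p.2) with hw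
  have hwu : ∀ x ∈ Icc 0 h1, ∀ y ∈ Icc 0 h2, w (x, y) = u (x, y) := by
    intro x hx y hy
    simp only [hw, projIcc_of_mem hh1.le hx, projIcc_of_mem hh2.le hy]
  have hwc : Continuous w := by
    refine hu.cont.comp_continuous (by fun_prop) fun p => ⟨Subtype.coe_prop _, Subtype.coe_prop _⟩
  have hKm : MeasurableSet (Khat h1 h2) := measurableSet_Ioo.prod measurableSet_Ioo
  have hwK : EqOn u w (Khat h1 h2) := fun p hp =>
    (hwu p.1 (Ioo_subset_Icc_self hp.1) p.2 (Ioo_subset_Icc_self hp.2)).symm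
  have hweak : WeakHelmholtz κ (Khat h1 h2) w := by
    refine ⟨integrableOn_Khat h1 h2 hwc, fun φ h1 h2 h3 => ?_⟩
    rw [← hu.helm.2 φ h1 h2 h3]
    refine setIntegral_congr_fun hKm fun p hp => ?_
    simp only [hwK hp]
  have hcoef := sine_coeff_eq hκ hh1 hh2 hA0 hwc
    (fun y => by simpa [hw] using hu.left _ (projIcc 0 h2 hh2.le y).2)
    (fun y => by simpa [hw] using hu.right _ (projIcc 0 h2 hh2.le y).2)
    (fun x => by simpa [hw] using hu.bottom _ (projIcc 0 h1 hh1.le x).2) hweak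
  rintro ⟨x, y⟩ ⟨hx, hy⟩
  have hxI := Ioo_subset_Icc_self hx
  have hyI := Ioo_subset_Icc_self hy
  have hcs := continuous_modeSeries_fst hκ hh1 hh2 hB 0 0 hy
  have hend : ∀ z, (∀ n, sinMode h1 0 n z = 0) → modeSeries κ h1 h2 b 0 0 (z, y) = 0 := by
    intro z hz
    simp [modeSeries, modeTerm, hz]
  rw [← hwu x hxI y hyI]
  refine sub_eq_zero.1 (eq_zero_of_sine_coeff_eq_zero hh1
    (f := fun x => w (x, y) - modeSeries κ h1 h2 b 0 0 (x, y)) (by fun_prop) ?_ ?_ ?_ x hxI)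
  · rw [hend 0 (sinMode_zero_left h1), hwu 0 ⟨le_rfl, hh1.le⟩ y hyI, hu.left y hyI, sub_zero]
  · rw [hend h1 (sinMode_zero_right hh1), hwu h1 ⟨hh1.le, le_rfl⟩ y hyI, hu.right y hyI, sub_zero]
  · intro n
    have hS : ∀ x, Real.sin (n * π / h1 * x) = sinMode h1 0 n x := fun x => by simp [sinMode]
    simp only [hS, sub_mul]
    rcases Nat.eq_zero_or_pos n with rfl | hn
    · simp [sinMode]
    have hSc := (contDiff_sinMode h1 0 n).continuous
    rw [intervalIntegral.integral_sub (Continuous.intervalIntegrable (by fun_prop) _ _)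
      (Continuous.intervalIntegrable (by fun_prop) _ _), hcoef n y hyI,
      integral_modeSeries_mul_sinMode hκ hh1 hh2 hB 0 0 hn hy]
    have e : ∫ x in (0 : ℝ)..h1, w (x, h2) * (sinMode h1 0 n x : ℂ) = b n * ((h1 / 2 : ℝ) : ℂ) := by
      rw [hbdef, ← integral_mul_sinMode_eq_sineCoeff hh1]
      refine intervalIntegral.integral_congr fun x hx => ?_
      rw [uIcc_of_le hh1.le] at hx
      simp only [traceTop, hwu x hx h2 ⟨hh2.le, le_rfl⟩]
    rw [e, iteratedDeriv_zero]
    ring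

/-- Fatou's lemma for Bochner integrals of nonnegative functions. -/
lemma integral_le_of_tendsto_ae {α : Type*} [MeasurableSpace α] {m : Measure α}
    {g : ℕ → α → ℝ} {f : α → ℝ} {W : ℝ} (hg : ∀ k, Integrable (g k) m) (hg0 : ∀ k x, 0 ≤ g k x)
    (hf0 : ∀ x, 0 ≤ f x)
    (hlim : ∀ᵐ x ∂m, Filter.Tendsto (fun k => g k x) Filter.atTop (nhds (f x)))
    (hW : ∀ k, ∫ x, g k x ∂m ≤ W) : ∫ x, f x ∂m ≤ W := by
  have hW0 : 0 ≤ W := (integral_nonneg (hg0 0)).trans (hW 0)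
  have hfm : AEStronglyMeasurable f m :=
    aestronglyMeasurable_of_tendsto_ae _ (fun k => (hg k).aestronglyMeasurable) hlim
  rw [integral_eq_lintegral_of_nonneg_ae (.of_forall hf0) hfm]
  refine ENNReal.toReal_le_of_le_ofReal hW0 ?_
  have h1 : ∫⁻ x, ENNReal.ofReal (f x) ∂m =
      ∫⁻ x, Filter.liminf (fun k => ENNReal.ofReal (g k x)) Filter.atTop ∂m := by
    refine lintegral_congr_ae ?_
    filter_upwards [hlim] with x hx
    exact ((ENNReal.continuous_ofReal.tendsto _).comp hx).liminf_eq.symm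
  rw [h1]
  refine (lintegral_liminf_le' fun k => (hg k).aemeasurable.ennreal_ofReal).trans ?_
  refine Filter.liminf_le_of_frequently_le' (Filter.Frequently.of_forall fun k => ?_)
  rw [← ofReal_integral_eq_lintegral_ofReal (hg k) (.of_forall (hg0 k))]
  exact ENNReal.ofReal_le_ofReal (hW k)

lemma nuHat_mono {κ h1 : ℝ} (hκ : 0 < κ) (hh1 : 0 < h1) {n m : ℕ} (h : n ≤ m) :
    nuHat κ h1 n ≤ nuHat κ h1 m := by
  unfold nuHat
  gcongr

lemma pow_div_le_rpow_sq_mul {a b : ℝ} (ha : 1 ≤ a) (hab : a ≤ b) {k r μ : ℕ} (hk : k ≤ r)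
    (hr : r ≤ μ) :
    b ^ (2 * k) / b ≤ (a ^ ((r : ℝ) - ((μ : ℝ) + 1 / 2))) ^ 2 * b ^ (2 * μ) := by
  have ha0 : 0 < a := by linarith
  have hb0 : 0 < b := by linarith
  have hrμ : (r : ℝ) ≤ μ := by exact_mod_cast hr
  have hmono : b ^ ((r : ℝ) - ((μ : ℝ) + 1 / 2)) ≤ a ^ ((r : ℝ) - ((μ : ℝ) + 1 / 2)) :=
    Real.rpow_le_rpow_of_nonpos ha0 hab (by linarith)
  have key : b ^ (2 * r) / b = (b ^ ((r : ℝ) - ((μ : ℝ) + 1 / 2))) ^ 2 * b ^ (2 * μ) := by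
    rw [← Real.rpow_natCast b (2 * r), ← Real.rpow_natCast b (2 * μ), ← Real.rpow_natCast _ 2,
      ← Real.rpow_mul hb0.le, ← Real.rpow_add hb0, ← Real.rpow_sub_one hb0.ne']
    congr 1
    push_cast
    ring
  calc b ^ (2 * k) / b ≤ b ^ (2 * r) / b := by
        gcongr
        linarith
    _ ≤ _ := by rw [key]; gcongr

section estimate

variable {κ h1 h2 : ℝ} {Ne r μ : ℕ} {b : ℕ → ℂ} {R : ℝ}

/-- The energy of a finite sum of evanescent modes. -/
lemma integral_norm_sum_modeTerm_sq (κ : ℝ) (hh1 : 0 < h1) (hh2 : 0 < h2) (b : ℕ → ℂ) (i j : ℕ)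
    (F : Finset ℕ) (hF : ∀ n ∈ F, 1 ≤ n) :
    ∫ p in Khat h1 h2, ‖∑ n ∈ F, modeTerm κ h1 h2 b i j n p‖ ^ 2 =
      ∑ n ∈ F, (n * π / h1) ^ (2 * i) * (‖b n‖ ^ 2 * (h1 / 2)) *
        ∫ y in (0 : ℝ)..h2, ‖iteratedDeriv j (vMode κ h1 h2 n) y‖ ^ 2 := by
  have hc := fun n => continuous_modeTerm κ h1 h2 b i j n
  have hv := fun n => continuous_iteratedDeriv_vMode κ h1 h2 j n
  rw [setIntegral_Khat' hh1 hh2 (integrableOn_Khat _ _ (by fun_prop))]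
  have e : ∀ y, ∫ x in (0 : ℝ)..h1, ‖∑ n ∈ F, modeTerm κ h1 h2 b i j n (x, y)‖ ^ 2 =
      ∑ n ∈ F, (n * π / h1) ^ (2 * i) * (‖b n‖ ^ 2 * (h1 / 2)) *
        ‖iteratedDeriv j (vMode κ h1 h2 n) y‖ ^ 2 := by
    intro y
    have := integral_normSq_sum_sinMode hh1 i F hF fun n =>
      b n * ((n * π / h1 : ℝ) : ℂ) ^ i * iteratedDeriv j (vMode κ h1 h2 n) y
    convert this using 1
    · refine intervalIntegral.integral_congr fun x _ => ?_
      refine congrArg (fun z : ℂ => ‖z‖ ^ 2) (Finset.sum_congr rfl fun n _ => ?_)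
      simp only [modeTerm]
      ring
    · refine Finset.sum_congr rfl fun n _ => ?_
      rw [norm_mul, norm_mul, norm_pow, Complex.norm_real, Real.norm_of_nonneg (by positivity)]
      ring
  simp only [e]
  rw [intervalIntegral.integral_finsetSum fun n _ =>
    Continuous.intervalIntegrable (by have := hv n; fun_prop) _ _]
  simp only [intervalIntegral.integral_const_mul]

lemma integral_norm_sum_modeTerm_sq_le (hκ : 0 < κ) (hh1 : 0 < h1) (hh2 : 0 < h2)
    (hnu : √2 ≤ nuHat κ h1 Ne) (hrμ : r ≤ μ)
    (hR : ∀ F : Finset ℕ, (∀ n ∈ F, Ne < n) →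
      ∑ n ∈ F, nuHat κ h1 n ^ (2 * μ) * (‖b n‖ ^ 2 * (h1 / 2)) ≤ R)
    {i j : ℕ} (hij : i + j ≤ r) (F : Finset ℕ) (hF : ∀ n ∈ F, Ne < n) :
    ∫ p in Khat h1 h2, ‖∑ n ∈ F, modeTerm κ h1 h2 b i j n p‖ ^ 2 ≤
      κ ^ (2 * (i + j)) * (√2 / (κ * Real.tanh (κ * h2)) *
        (nuHat κ h1 Ne ^ ((r : ℝ) - ((μ : ℝ) + 1 / 2))) ^ 2 * R) := by
  rw [integral_norm_sum_modeTerm_sq κ hh1 hh2 b i j F fun n hn => (Nat.zero_le _).trans_lt (hF n hn)]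
  set D := nuHat κ h1 Ne ^ ((r : ℝ) - ((μ : ℝ) + 1 / 2))
  have hT : 0 < Real.tanh (κ * h2) := by
    rw [Real.tanh_eq_sinh_div_cosh]
    exact div_pos (Real.sinh_pos_iff.2 (by positivity)) (Real.cosh_pos _)
  have h1le : 1 ≤ nuHat κ h1 Ne := (Real.one_le_sqrt.2 (by norm_num)).trans hnu
  calc _ ≤ ∑ n ∈ F, κ ^ (2 * (i + j)) * (√2 / (κ * Real.tanh (κ * h2)) * D ^ 2) *
        (nuHat κ h1 n ^ (2 * μ) * (‖b n‖ ^ 2 * (h1 / 2))) := by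
        refine Finset.sum_le_sum fun n hn => ?_
        have hmono := nuHat_mono hκ hh1 (hF n hn).le
        have hv := integral_norm_iteratedDeriv_vMode_sq_le hκ hh2 (hnu.trans hmono) j
        have hν : 0 < nuHat κ h1 n := by linarith
        have hp := pow_div_le_rpow_sq_mul h1le hmono hij hrμ
        rw [← mul_nuHat hκ]
        calc _ ≤ (κ * nuHat κ h1 n) ^ (2 * i) * (‖b n‖ ^ 2 * (h1 / 2)) *
              ((κ * nuHat κ h1 n) ^ (2 * j) * (√2 / (κ * nuHat κ h1 n * Real.tanh (κ * h2)))) := by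
              gcongr
          _ = κ ^ (2 * (i + j)) * (√2 / (κ * Real.tanh (κ * h2))) * (‖b n‖ ^ 2 * (h1 / 2)) *
              (nuHat κ h1 n ^ (2 * (i + j)) / nuHat κ h1 n) := by
              field_simp
              ring
          _ ≤ κ ^ (2 * (i + j)) * (√2 / (κ * Real.tanh (κ * h2))) * (‖b n‖ ^ 2 * (h1 / 2)) *
              (D ^ 2 * nuHat κ h1 n ^ (2 * μ)) := by gcongr
          _ = _ := by ring
    _ = κ ^ (2 * (i + j)) * (√2 / (κ * Real.tanh (κ * h2)) * D ^ 2) *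
        ∑ n ∈ F, nuHat κ h1 n ^ (2 * μ) * (‖b n‖ ^ 2 * (h1 / 2)) := by rw [Finset.mul_sum]
    _ ≤ κ ^ (2 * (i + j)) * (√2 / (κ * Real.tanh (κ * h2)) * D ^ 2) * R := by
        gcongr
        exact hR F hF
    _ = _ := by ring

/-- Sobolev bound for the tail of a series of modes. -/
lemma sobNormSq_le_of_eqOn_modeSeries (hκ : 0 < κ) (hh1 : 0 < h1) (hh2 : 0 < h2)
    (hnu : √2 ≤ nuHat κ h1 Ne) (hrμ : r ≤ μ) {B : ℝ} (hb : ∀ n, ‖b n‖ ≤ B)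
    (hb0 : ∀ n ≤ Ne, b n = 0)
    (hR : ∀ F : Finset ℕ, (∀ n ∈ F, Ne < n) →
      ∑ n ∈ F, nuHat κ h1 n ^ (2 * μ) * (‖b n‖ ^ 2 * (h1 / 2)) ≤ R)
    {f : ℝ × ℝ → ℂ} (hf : EqOn f (modeSeries κ h1 h2 b 0 0) (Khat h1 h2)) :
    sobNormSq κ r (Khat h1 h2) f ≤ (r + 1) ^ 2 * (√2 / (κ * Real.tanh (κ * h2)) *
        (nuHat κ h1 Ne ^ ((r : ℝ) - ((μ : ℝ) + 1 / 2))) ^ 2 * R) := by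
  have hKm : MeasurableSet (Khat h1 h2) := measurableSet_Ioo.prod measurableSet_Ioo
  have hT : 0 < Real.tanh (κ * h2) := by
    rw [Real.tanh_eq_sinh_div_cosh]
    exact div_pos (Real.sinh_pos_iff.2 (by positivity)) (Real.cosh_pos _)
  have hR0 : 0 ≤ R := by simpa using hR ∅ (by simp)
  set W := √2 / (κ * Real.tanh (κ * h2)) *
        (nuHat κ h1 Ne ^ ((r : ℝ) - ((μ : ℝ) + 1 / 2))) ^ 2 * R with hW
  have hW0 : 0 ≤ W := by positivity
  have hterm : ∀ p ∈ idxLe r,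
      (κ ^ (2 * (p.1 + p.2)))⁻¹ * ∫ x in Khat h1 h2, ‖pdM p.1 p.2 f x‖ ^ 2 ≤ W := by
    rintro ⟨i, j⟩ hp
    have hij : i + j ≤ r := (Finset.mem_filter.1 hp).2
    rw [inv_mul_le_iff₀ (by positivity)]
    have e : ∫ x in Khat h1 h2, ‖pdM i j f x‖ ^ 2 =
        ∫ x in Khat h1 h2, ‖modeSeries κ h1 h2 b i j x‖ ^ 2 :=
      setIntegral_congr_fun hKm fun x hx => by
        simp only [pdM_eq_modeSeries hκ hh1 hh2 hb hf i j hx]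
    rw [e]
    have hc := fun n => continuous_modeTerm κ h1 h2 b i j n
    refine integral_le_of_tendsto_ae
      (g := fun k p => ‖∑ n ∈ Finset.range k, modeTerm κ h1 h2 b i j n p‖ ^ 2)
      (fun k => integrableOn_Khat _ _ (by fun_prop)) (fun _ _ => by positivity)
      (fun _ => by positivity) ?_ fun k => ?_
    · filter_upwards [ae_restrict_mem hKm] with p hp
      exact (((summable_modeTerm hκ hh1 hh2 hb i j
        (Ioo_subset_Ico_self hp.2)).hasSum.tendsto_sum_nat).norm).pow 2
    · have e2 : ∀ p, ∑ n ∈ Finset.range k, modeTerm κ h1 h2 b i j n p =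
          ∑ n ∈ (Finset.range k).filter (Ne < ·), modeTerm κ h1 h2 b i j n p := by
        intro p
        rw [Finset.sum_filter]
        refine Finset.sum_congr rfl fun n _ => ?_
        split_ifs with h
        · rfl
        · simp [modeTerm, hb0 n (not_lt.1 h)]
      simp only [e2]
      exact integral_norm_sum_modeTerm_sq_le hκ hh1 hh2 hnu hrμ hR hij _
        fun n hn => (Finset.mem_filter.1 hn).2
  have hcard : ((idxLe r).card : ℝ) ≤ (r + 1) ^ 2 := by
    have : (idxLe r).card ≤ (r + 1) * (r + 1) :=
      (Finset.card_filter_le _ _).trans (by simp)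
    rw [sq]
    exact_mod_cast this
  calc sobNormSq κ r (Khat h1 h2) f ≤ (idxLe r).card • W := Finset.sum_le_card_nsmul _ _ _ hterm
    _ ≤ _ := by
        rw [nsmul_eq_mul]
        gcongr

end estimate

lemma sum_sineCoeff_le_traceSemiSq {κ h1 h2 : ℝ} (hκ : 0 < κ) (hh1 : 0 < h1) {N M : ℕ}
    {u : ℝ × ℝ → ℂ} (hu : SLoc κ h1 h2 N M u) {μ : ℕ} (hμ : μ ≤ min (2 * N) M) (F : Finset ℕ)
    (hF : ∀ n ∈ F, 1 ≤ n) :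
    ∑ n ∈ F, nuHat κ h1 n ^ (2 * μ) * (‖sineCoeff h1 (traceTop h2 u) n‖ ^ 2 * (h1 / 2)) ≤
      traceSemiSq κ h1 h2 μ u := by
  have h := sum_normSq_coeff_le hh1 μ F hF
    (fun n => ((n * π / h1 : ℝ) : ℂ) ^ μ * sineCoeff h1 (traceTop h2 u) n)
    (hu.traceReg.continuousOn_iteratedDerivWithin
      (by exact_mod_cast hμ.trans (min_le_right _ _)) (uniqueDiffOn_Icc hh1)) fun n _ => by
        rw [integral_iteratedDerivWithin_mul_sinMode hh1 hu.traceReg hu.endpt0 hu.endpt1 hμ n,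
          integral_mul_sinMode_eq_sineCoeff hh1, mul_assoc]
  rw [traceSemiSq, le_inv_mul_iff₀ (by positivity), Finset.mul_sum]
  refine le_of_eq_of_le (Finset.sum_congr rfl fun n _ => ?_) h
  rw [norm_mul, norm_pow, Complex.norm_real, ← mul_nuHat hκ, Real.norm_of_nonneg, mul_pow, ← pow_mul,
    mul_pow]
  · ring
  · rw [mul_nuHat hκ]; positivity

lemma mem_idxLe {i j M : ℕ} (h : i + j ≤ M) : (i, j) ∈ idxLe M := by
  simp only [idxLe, Finset.mem_filter, Finset.mem_product, Finset.mem_range]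
  omega

lemma sum_sineCoeff_le_sobNormSq {κ h1 h2 : ℝ} (hκ : 0 < κ) (hh1 : 0 < h1) (hh2 : 0 < h2)
    (hA0 : A0cond κ h1 h2) {N M : ℕ} {u : ℝ × ℝ → ℂ} (hu : SLoc κ h1 h2 N M u) {μ : ℕ}
    (hμ : μ ≤ M) (hmem : MemSob (M + 1) (Khat h1 h2) u) (F : Finset ℕ)
    (hF : ∀ n ∈ F, 1 ≤ n ∧ √2 ≤ nuHat κ h1 n) :
    ∑ n ∈ F, nuHat κ h1 n ^ (2 * μ) * (‖sineCoeff h1 (traceTop h2 u) n‖ ^ 2 * (h1 / 2)) ≤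
      2 * κ * sobNormSq κ (μ + 1) (Khat h1 h2) u := by
  obtain ⟨B, hB⟩ := exists_norm_sineCoeff_le hh1 (g := traceTop h2 u)
    (hu.cont.comp (by fun_prop) fun x hx => ⟨hx, hh2.le, le_rfl⟩)
  have hub := hu.eqOn_modeSeries hκ hh1 hh2 hA0
  set b := sineCoeff h1 (traceTop h2 u)
  have hKm : MeasurableSet (Khat h1 h2) := measurableSet_Ioo.prod measurableSet_Ioo
  have heq := pdM_eq_modeSeries hκ hh1 hh2 hB hub μ 1
  have hint : IntegrableOn (fun p => ‖modeSeries κ h1 h2 b μ 1 p‖ ^ 2) (Khat h1 h2) :=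
    (hmem (μ, 1) (mem_idxLe (by omega))).congr_fun (fun p hp => by simp only [heq hp]) hKm
  have hv := fun n => continuous_iteratedDeriv_vMode κ h1 h2 1 n
  have hbessel : ∀ y ∈ Ioo 0 h2, ∑ n ∈ F, (n * π / h1) ^ (2 * μ) * (‖b n‖ ^ 2 * (h1 / 2)) *
      ‖iteratedDeriv 1 (vMode κ h1 h2 n) y‖ ^ 2 ≤
      ∫ x in (0 : ℝ)..h1, ‖modeSeries κ h1 h2 b μ 1 (x, y)‖ ^ 2 := by
    intro y hy
    have h := sum_normSq_coeff_le hh1 μ F (fun n hn => (hF n hn).1)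
      (fun n => b n * ((n * π / h1 : ℝ) : ℂ) ^ μ * iteratedDeriv 1 (vMode κ h1 h2 n) y)
      (continuous_modeSeries_fst hκ hh1 hh2 hB μ 1 hy).continuousOn fun n hn =>
        integral_modeSeries_mul_sinMode hκ hh1 hh2 hB μ 1 (hF n hn).1 hy
    refine le_of_eq_of_le (Finset.sum_congr rfl fun n _ => ?_) h
    rw [norm_mul, norm_mul, norm_pow, Complex.norm_real, Real.norm_of_nonneg (by positivity)]
    ring
  have hint2 : IntervalIntegrable
      (fun y => ∫ x in (0 : ℝ)..h1, ‖modeSeries κ h1 h2 b μ 1 (x, y)‖ ^ 2) volume 0 h2 := by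
    rw [intervalIntegrable_iff_integrableOn_Ioo_of_le hh2.le]
    simp only [intervalIntegral.integral_of_le hh1.le, integral_Ioc_eq_integral_Ioo]
    rw [IntegrableOn, Khat, Measure.volume_eq_prod, ← Measure.prod_restrict] at hint
    exact hint.integral_prod_right
  have hsum := intervalIntegral.integral_mono_on_of_le_Ioo hh2.le
    (Continuous.intervalIntegrable (by fun_prop) _ _) hint2 hbessel
  rw [← setIntegral_Khat' hh1 hh2 hint, intervalIntegral.integral_finsetSum fun n _ =>
    Continuous.intervalIntegrable (by have := hv n; fun_prop) _ _] at hsum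
  simp only [intervalIntegral.integral_const_mul] at hsum
  have hle : ∫ p in Khat h1 h2, ‖modeSeries κ h1 h2 b μ 1 p‖ ^ 2 ≤
      κ ^ (2 * (μ + 1)) * sobNormSq κ (μ + 1) (Khat h1 h2) u := by
    rw [← inv_mul_le_iff₀ (by positivity)]
    have e : ∫ p in Khat h1 h2, ‖modeSeries κ h1 h2 b μ 1 p‖ ^ 2 =
        ∫ p in Khat h1 h2, ‖pdM μ 1 u p‖ ^ 2 :=
      setIntegral_congr_fun hKm fun p hp => by simp only [heq hp]
    rw [e]
    exact Finset.single_le_sum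
      (f := fun p : ℕ × ℕ => (κ ^ (2 * (p.1 + p.2)))⁻¹ * ∫ x in Khat h1 h2, ‖pdM p.1 p.2 u x‖ ^ 2)
      (fun p _ => mul_nonneg (by positivity) (integral_nonneg fun _ => by positivity))
      (mem_idxLe (i := μ) (j := 1) le_rfl)
  have hlow : κ ^ (2 * μ) * (κ / 2) *
      ∑ n ∈ F, nuHat κ h1 n ^ (2 * μ) * (‖b n‖ ^ 2 * (h1 / 2)) ≤
      ∑ n ∈ F, (n * π / h1) ^ (2 * μ) * (‖b n‖ ^ 2 * (h1 / 2)) *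
        ∫ y in (0 : ℝ)..h2, ‖iteratedDeriv 1 (vMode κ h1 h2 n) y‖ ^ 2 := by
    rw [Finset.mul_sum]
    refine Finset.sum_le_sum fun n hn => ?_
    have h := le_integral_norm_deriv_vMode_sq hκ hh2 (hF n hn).2
    calc _ = (n * π / h1) ^ (2 * μ) * (‖b n‖ ^ 2 * (h1 / 2)) * (κ / 2) := by
          rw [← mul_nuHat hκ]; ring
      _ ≤ _ := by gcongr
  have hfin := hlow.trans (hsum.trans hle)
  have hpos : 0 < κ ^ (2 * μ) * (κ / 2) := by positivity
  refine le_of_mul_le_mul_left (hfin.trans_eq ?_) hpos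
  ring

/-- Truncating the mode expansion bounds the best approximation error. -/
lemma sInf_sobNorm_le {κ h1 h2 : ℝ} (hκ : 0 < κ) (hh1 : 0 < h1) (hh2 : 0 < h2)
    (hA0 : A0cond κ h1 h2) {N M r μ Ne : ℕ} (hrμ : r ≤ μ) (hnu : √2 ≤ nuHat κ h1 Ne)
    {u : ℝ × ℝ → ℂ} (hu : SLoc κ h1 h2 N M u) {R C : ℝ}
    (hR : ∀ F : Finset ℕ, (∀ n ∈ F, Ne < n) →
      ∑ n ∈ F, nuHat κ h1 n ^ (2 * μ) * (‖sineCoeff h1 (traceTop h2 u) n‖ ^ 2 * (h1 / 2)) ≤ R)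
    (hC0 : 0 ≤ C)
    (hC : (r + 1) ^ 2 * (√2 / (κ * Real.tanh (κ * h2)) *
        (nuHat κ h1 Ne ^ ((r : ℝ) - ((μ : ℝ) + 1 / 2))) ^ 2 * R) ≤ C ^ 2) :
    sInf {E : ℝ | ∃ v ∈ Submodule.span ℂ ((phiHat κ h1 h2) '' {k : ℕ | 1 ≤ k ∧ k ≤ Ne}),
      E = sobNorm κ r (Khat h1 h2) (u - v)} ≤ C := by
  obtain ⟨B, hB⟩ := exists_norm_sineCoeff_le hh1 (g := traceTop h2 u)
    (hu.cont.comp (by fun_prop) fun x hx => ⟨hx, hh2.le, le_rfl⟩)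
  have hub := hu.eqOn_modeSeries hκ hh1 hh2 hA0
  set b := sineCoeff h1 (traceTop h2 u)
  set b' : ℕ → ℂ := fun n => if n ≤ Ne then 0 else b n with hb'
  have hB' : ∀ n, ‖b' n‖ ≤ B := by
    intro n
    by_cases h : n ≤ Ne
    · simpa [hb', h] using (norm_nonneg _).trans (hB 0)
    · simpa [hb', h] using hB n
  set v : ℝ × ℝ → ℂ := ∑ n ∈ Finset.Icc 1 Ne, b n • phiHat κ h1 h2 n with hv
  have hvspan : v ∈ Submodule.span ℂ ((phiHat κ h1 h2) '' {k : ℕ | 1 ≤ k ∧ k ≤ Ne}) :=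
    Submodule.sum_mem _ fun n hn => Submodule.smul_mem _ _
      (Submodule.subset_span ⟨n, Finset.mem_Icc.1 hn, rfl⟩)
  have heq : EqOn (u - v) (modeSeries κ h1 h2 b' 0 0) (Khat h1 h2) := by
    intro p hp
    have hpI : p.2 ∈ Ico 0 h2 := Ioo_subset_Ico_self hp.2
    have hd : modeSeries κ h1 h2 b 0 0 p - modeSeries κ h1 h2 b' 0 0 p = v p := by
      rw [modeSeries, modeSeries, ← (summable_modeTerm hκ hh1 hh2 hB 0 0 hpI).tsum_sub
        (summable_modeTerm hκ hh1 hh2 hB' 0 0 hpI), tsum_eq_sum (s := Finset.Icc 1 Ne), hv,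
        Finset.sum_apply]
      · refine Finset.sum_congr rfl fun n hn => ?_
        simp only [modeTerm, hb', (Finset.mem_Icc.1 hn).2, if_true, Pi.smul_apply, smul_eq_mul,
          phiHat_eq hκ, iteratedDeriv_zero]
        ring
      · intro n hn
        rcases Nat.eq_zero_or_pos n with rfl | hn0
        · simp [modeTerm, sinMode]
        · have : ¬ n ≤ Ne := fun h => hn (Finset.mem_Icc.2 ⟨hn0, h⟩)
          simp [modeTerm, hb', this]
    rw [Pi.sub_apply, hub hp, ← hd, sub_sub_cancel]
  refine csInf_le_of_le (b := sobNorm κ r (Khat h1 h2) (u - v)) ⟨0, ?_⟩ ⟨v, hvspan, rfl⟩ ?_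
  · rintro _ ⟨w, -, rfl⟩
    exact Real.sqrt_nonneg _
  · refine Real.sqrt_le_iff.2 ⟨hC0, (sobNormSq_le_of_eqOn_modeSeries hκ hh1 hh2 hnu hrμ hB'
      (fun n hn => if_pos hn) (fun F hF => ?_) heq).trans hC⟩
    refine le_of_eq_of_le (Finset.sum_congr rfl fun n hn => ?_) (hR F hF)
    simp only [hb', if_neg (not_le.2 (hF n hn))]

/-- Proposition 2.8, local edge-based approximation: under Assumption A0,
for `u ∈ S^{N,M}_κ(K̂,ŝ)` and `ν̂_{N_e} ≥ √2`, the best-approximation error in the span of the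
first `N_e` single-edge Helmholtz modes decays like `ν̂_{N_e}^{r−(μ+1/2)}`, controlled by the
trace seminorm `|u|_{H^μ_κ(ŝ)}`, and (if `u ∈ H^{M+1}_κ(K̂)`) by `‖u‖_{H^{μ+1}_κ(K̂)}`. -/
theorem local_edge_approximation (κ h1 h2 : ℝ) (hκ : 0 < κ) (hh1 : 0 < h1) (hh2 : 0 < h2)
    (hA0 : A0cond κ h1 h2) (N M : ℕ) (hN : 1 ≤ N) (hM : 1 ≤ M) (hNM : N ≤ (M + 1) / 2)
    (r μ : ℕ) (hrμ : r ≤ μ) (hμ : μ ≤ min (2 * N) M)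
    (Ne : ℕ) (hNe : 1 ≤ Ne) (hnu : Real.sqrt 2 ≤ nuHat κ h1 Ne)
    (u : ℝ × ℝ → ℂ) (hu : SLoc κ h1 h2 N M u) :
    sInf {E : ℝ | ∃ v ∈ Submodule.span ℂ ((phiHat κ h1 h2) '' {k : ℕ | 1 ≤ k ∧ k ≤ Ne}),
          E = sobNorm κ r (Khat h1 h2) (u - v)} ≤
        (Real.sqrt 2 * (r + 1) / Real.sqrt (κ * Real.tanh (κ * h2))) *
          nuHat κ h1 Ne ^ ((r : ℝ) - ((μ : ℝ) + 1 / 2)) *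
          Real.sqrt (traceSemiSq κ h1 h2 μ u) ∧
    (MemSob (M + 1) (Khat h1 h2) u →
      sInf {E : ℝ | ∃ v ∈ Submodule.span ℂ ((phiHat κ h1 h2) '' {k : ℕ | 1 ≤ k ∧ k ≤ Ne}),
          E = sobNorm κ r (Khat h1 h2) (u - v)} ≤
        (2 * (r + 1) * max 1 (κ * h2) / Real.sqrt (κ * h2 * Real.tanh (κ * h2))) *
          nuHat κ h1 Ne ^ ((r : ℝ) - ((μ : ℝ) + 1 / 2)) *
          sobNorm κ (μ + 1) (Khat h1 h2) u) := by
  have hT : 0 < Real.tanh (κ * h2) := by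
    rw [Real.tanh_eq_sinh_div_cosh]
    exact div_pos (Real.sinh_pos_iff.2 (by positivity)) (Real.cosh_pos _)
  have hν : 0 ≤ nuHat κ h1 Ne := (Real.sqrt_nonneg _).trans hnu
  have hD := Real.rpow_nonneg hν ((r : ℝ) - ((μ : ℝ) + 1 / 2))
  have hpos : ∀ F : Finset ℕ, (∀ n ∈ F, Ne < n) → ∀ n ∈ F, 1 ≤ n :=
    fun F hF n hn => (Nat.zero_le _).trans_lt (hF n hn)
  have h2sq : √2 ^ 2 = 2 := Real.sq_sqrt (by norm_num)
  have h2le : √2 ≤ 2 := Real.sqrt_le_iff.2 (by norm_num)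
  refine ⟨?_, fun hmem => ?_⟩
  · refine sInf_sobNorm_le hκ hh1 hh2 hA0 hrμ hnu hu
      (fun F hF => sum_sineCoeff_le_traceSemiSq hκ hh1 hu hμ F (hpos F hF)) (by positivity) ?_
    have hS : 0 ≤ traceSemiSq κ h1 h2 μ u :=
      mul_nonneg (by positivity) (intervalIntegral.integral_nonneg hh1.le fun _ _ => by positivity)
    rw [mul_pow, mul_pow, div_pow, mul_pow, Real.sq_sqrt hS, h2sq,
      Real.sq_sqrt (by positivity : 0 ≤ κ * Real.tanh (κ * h2))]
    calc _ ≤ ((r : ℝ) + 1) ^ 2 * (2 / (κ * Real.tanh (κ * h2)) *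
          (nuHat κ h1 Ne ^ ((r : ℝ) - ((μ : ℝ) + 1 / 2))) ^ 2 * traceSemiSq κ h1 h2 μ u) := by gcongr
      _ = _ := by ring
  · refine sInf_sobNorm_le hκ hh1 hh2 hA0 hrμ hnu hu
      (fun F hF => sum_sineCoeff_le_sobNormSq hκ hh1 hh2 hA0 hu (hμ.trans (min_le_right _ _)) hmem F
        fun n hn => ⟨hpos F hF n hn, hnu.trans (nuHat_mono hκ hh1 (hF n hn).le)⟩)
      (mul_nonneg (by positivity) (Real.sqrt_nonneg _)) ?_
    have hS : 0 ≤ sobNormSq κ (μ + 1) (Khat h1 h2) u := Finset.sum_nonneg fun p _ =>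
      mul_nonneg (by positivity) (integral_nonneg fun _ => by positivity)
    have hmax : κ * h2 ≤ max 1 (κ * h2) ^ 2 := by
      nlinarith [le_max_left 1 (κ * h2), le_max_right 1 (κ * h2)]
    rw [mul_pow, mul_pow, div_pow, sobNorm, Real.sq_sqrt hS, Real.sq_sqrt (by positivity)]
    set D := nuHat κ h1 Ne ^ ((r : ℝ) - ((μ : ℝ) + 1 / 2))
    set S := sobNormSq κ (μ + 1) (Khat h1 h2) u
    calc _ ≤ ((r : ℝ) + 1) ^ 2 * (2 / (κ * Real.tanh (κ * h2)) * D ^ 2 * (2 * κ * S)) := by gcongr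
      _ = 4 * (r + 1) ^ 2 * (κ * h2) / (κ * h2 * Real.tanh (κ * h2)) * D ^ 2 * S := by
          field_simp
          ring
      _ ≤ 4 * (r + 1) ^ 2 * max 1 (κ * h2) ^ 2 / (κ * h2 * Real.tanh (κ * h2)) * D ^ 2 * S := by
          gcongr
      _ = _ := by ring

end
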